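/- arXiv:1307.0120 — 2 statements merged into one kernel-verified Lean document; each statement's English description precedes it below -/
import Mathlib

section
/- Let X be a compact metric space and let f : X → X be a continuous map with the shadowing property. Then the following conditions are equivalent: (1) f is totally transitive; (2) f is topologically weakly mixing; (3) f is topologically mixing; (4) f is surjective and has the almost specification property; (5) f is surjective and has the asymptotic average shadowing property; (6) f is surjective and has the average shadowing property. -/
open Filter Metric Set MeasureTheory Topology

section Defs

variable {X : Type*} [MetricSpace X]

/-- The Bowen ball of radius `ε` centered at `x` along a finite set of times `Λ`. -/
def bowenBallAlong (f : X → X) (Λ : Finset ℕ) (x : X) (ε : ℝ) : Set X :=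
  {y | ∀ j ∈ Λ, dist (f^[j] x) (f^[j] y) < ε}

/-- `g` is a mistake function with threshold `ε₀`. -/
structure IsMistakeFun (g : ℕ → ℝ → ℕ) (ε₀ : ℝ) : Prop where
  pos : 0 < ε₀
  mono : ∀ n : ℕ, ∀ ε : ℝ, 0 < ε → ε ≤ ε₀ → g n ε ≤ g (n + 1) ε
  small : ∀ ε : ℝ, 0 < ε → ε ≤ ε₀ →
    Tendsto (fun n : ℕ => (g n ε : ℝ) / n) atTop (nhds 0)
  ext : ∀ n : ℕ, ∀ ε : ℝ, ε₀ < ε → g n ε = g n ε₀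

/-- The `(g;n,ε)`-Bowen ball `B_n(g;x,ε)`: union of Bowen balls along all
`Λ ⊆ {0,…,n-1}` with `#Λ ≥ n - g(n,ε)`. -/
def mistakeBowenBall (f : X → X) (g : ℕ → ℝ → ℕ) (n : ℕ) (x : X) (ε : ℝ) : Set X :=
  ⋃ Λ ∈ {Λ : Finset ℕ | Λ ⊆ Finset.range n ∧ n - g n ε ≤ Λ.card},
    bowenBallAlong f Λ x ε

/-- Almost specification property with given mistake function `g` and gap function `kg`. -/
def AlmostSpecWith (f : X → X) (g : ℕ → ℝ → ℕ) (kg : ℝ → ℕ) : Prop :=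
  ∀ m : ℕ, 1 ≤ m → ∀ (ε : ℕ → ℝ) (x : ℕ → X) (nseq : ℕ → ℕ),
    (∀ j, 1 ≤ j → j ≤ m → 0 < ε j) →
    (∀ j, 1 ≤ j → j ≤ m → kg (ε j) ≤ nseq j) →
    ∃ z : X, ∀ j, 1 ≤ j → j ≤ m →
      f^[∑ s ∈ Finset.Ico 1 j, nseq s] z ∈ mistakeBowenBall f g (nseq j) (x j) (ε j)

/-- The almost specification property. -/
def AlmostSpec (f : X → X) : Prop :=
  ∃ (g : ℕ → ℝ → ℕ) (ε₀ : ℝ) (kg : ℝ → ℕ),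
    IsMistakeFun g ε₀ ∧ AlmostSpecWith f g kg

/-- `{x_n}` is a `δ`-average-pseudo-orbit of `f`. -/
def AvgPseudoOrbit (f : X → X) (δ : ℝ) (x : ℕ → X) : Prop :=
  ∃ N : ℕ, 0 < N ∧ ∀ n : ℕ, N ≤ n → ∀ k : ℕ,
    (∑ i ∈ Finset.range n, dist (f (x (i + k))) (x (i + k + 1))) / n < δ

/-- `{x_n}` is `ε`-shadowed in average by `y`. -/
def ShadowedInAvg (f : X → X) (ε : ℝ) (x : ℕ → X) (y : X) : Prop :=
  limsup (fun n : ℕ => (∑ i ∈ Finset.range n, dist (f^[i] y) (x i)) / n) atTop < ε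

/-- The average shadowing property. -/
def AvgShadowing (f : X → X) : Prop :=
  ∀ ε : ℝ, 0 < ε → ∃ δ : ℝ, 0 < δ ∧
    ∀ x : ℕ → X, AvgPseudoOrbit f δ x → ∃ y : X, ShadowedInAvg f ε x y

/-- `{x_n}` is an asymptotic average pseudo-orbit of `f`. -/
def AsympAvgPseudoOrbit (f : X → X) (x : ℕ → X) : Prop :=
  Tendsto (fun n : ℕ => (∑ i ∈ Finset.range n, dist (f (x i)) (x (i + 1))) / n)
    atTop (nhds 0)

/-- `{x_n}` is asymptotically shadowed in average by `y`. -/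
def AsympShadowedInAvg (f : X → X) (x : ℕ → X) (y : X) : Prop :=
  Tendsto (fun n : ℕ => (∑ i ∈ Finset.range n, dist (f^[i] y) (x i)) / n)
    atTop (nhds 0)

/-- The asymptotic average shadowing property. -/
def AsympAvgShadowing (f : X → X) : Prop :=
  ∀ x : ℕ → X, AsympAvgPseudoOrbit f x → ∃ y : X, AsympShadowedInAvg f x y

/-- An infinite `δ`-pseudo-orbit. -/
def PseudoOrbit (f : X → X) (δ : ℝ) (x : ℕ → X) : Prop :=
  ∀ i : ℕ, dist (f (x i)) (x (i + 1)) < δ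

/-- There exists a finite `δ`-pseudo-orbit of length `n` from `x` to `y`. -/
def FinChain (f : X → X) (δ : ℝ) (n : ℕ) (x y : X) : Prop :=
  ∃ c : ℕ → X, c 0 = x ∧ c n = y ∧ ∀ i < n, dist (f (c i)) (c (i + 1)) < δ

/-- Chain transitivity. -/
def ChainTransitive (f : X → X) : Prop :=
  ∀ δ : ℝ, 0 < δ → ∀ x y : X, ∃ n : ℕ, 0 < n ∧ FinChain f δ n x y

/-- Chain mixing. -/
def ChainMixing (f : X → X) : Prop :=
  ∀ δ : ℝ, 0 < δ → ∀ x y : X, ∃ N : ℕ, 0 < N ∧ ∀ n : ℕ, N ≤ n → FinChain f δ n x y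

/-- The shadowing property. -/
def Shadowing (f : X → X) : Prop :=
  ∀ ε : ℝ, 0 < ε → ∃ δ : ℝ, 0 < δ ∧
    ∀ x : ℕ → X, PseudoOrbit f δ x → ∃ z : X, ∀ i : ℕ, dist (f^[i] z) (x i) < ε

/-- The limit shadowing property. -/
def LimitShadowing (f : X → X) : Prop :=
  ∀ x : ℕ → X, Tendsto (fun i : ℕ => dist (f (x i)) (x (i + 1))) atTop (nhds 0) →
    ∃ z : X, Tendsto (fun i : ℕ => dist (f^[i] z) (x i)) atTop (nhds 0)

/-- Topological transitivity. -/
def TopTransitive {Y : Type*} [TopologicalSpace Y] (f : Y → Y) : Prop :=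
  ∀ U V : Set Y, IsOpen U → IsOpen V → U.Nonempty → V.Nonempty →
    ∃ n : ℕ, 0 < n ∧ (f^[n] '' U ∩ V).Nonempty

/-- Total transitivity. -/
def TotallyTransitive {Y : Type*} [TopologicalSpace Y] (f : Y → Y) : Prop :=
  ∀ n : ℕ, 1 ≤ n → TopTransitive f^[n]

/-- Topological weak mixing: `f × f` is transitive. -/
def WeaklyMixing {Y : Type*} [TopologicalSpace Y] (f : Y → Y) : Prop :=
  TopTransitive (Prod.map f f)

/-- Topological mixing. -/
def TopMixing {Y : Type*} [TopologicalSpace Y] (f : Y → Y) : Prop :=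
  ∀ U V : Set Y, IsOpen U → IsOpen V → U.Nonempty → V.Nonempty →
    ∃ N : ℕ, 0 < N ∧ ∀ n : ℕ, N ≤ n → (f^[n] '' U ∩ V).Nonempty

/-- The forward orbit of a point. -/
def fOrbit (f : X → X) (x : X) : Set X := Set.range fun n : ℕ => f^[n] x

/-- `x` is a minimal point of `f`: every point of the orbit closure of `x`
has orbit dense in that orbit closure. -/
def MinimalPoint (f : X → X) (x : X) : Prop :=
  ∀ y ∈ closure (fOrbit f x), closure (fOrbit f x) ⊆ closure (fOrbit f y)

variable [MeasurableSpace X]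

/-- `μ` is an `f`-invariant Borel probability measure. -/
def InvariantProb (f : X → X) (μ : Measure X) : Prop :=
  IsProbabilityMeasure μ ∧ ∀ B : Set X, MeasurableSet B → μ (f ⁻¹' B) = μ B

/-- A set is universally null if it has measure zero for every invariant
probability measure. -/
def UnivNull (f : X → X) (U : Set X) : Prop :=
  ∀ μ : Measure X, InvariantProb f μ → μ U = 0

/-- The measure center: complement of the union of all universally null open sets. -/
def measureCenter (f : X → X) : Set X :=
  (⋃ U ∈ {U : Set X | IsOpen U ∧ UnivNull f U}, U)ᶜ

/-- `μ` has full support. -/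
def FullSupport (μ : Measure X) : Prop :=
  ∀ U : Set X, IsOpen U → U.Nonempty → 0 < μ U

end Defs

section Visits

variable {X : Type*} [MetricSpace X]

/-- The set of visiting times `N(x,U)`. -/
def visitTimes (f : X → X) (x : X) (U : Set X) : Set ℕ :=
  {n : ℕ | 0 < n ∧ f^[n] x ∈ U}

/-- `η(n,U) = max_{x ∈ X} #(N(x,U) ∩ {0,…,n-1})`. -/
noncomputable def eta (f : X → X) (U : Set X) (n : ℕ) : ℕ :=
  sSup {k : ℕ | ∃ x : X, k = (visitTimes f x U ∩ Set.Iio n).ncard}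

/-- The visit frequency `ξ(U) = inf_{n>0} η(n,U)/n`. -/
noncomputable def xi (f : X → X) (U : Set X) : ℝ :=
  ⨅ n : ℕ, (eta f U (n + 1) : ℝ) / (n + 1)

/-- `J ⊆ ℕ` has asymptotic density `a`. -/
def HasDensity (J : Set ℕ) (a : ℝ) : Prop :=
  Tendsto (fun n : ℕ => ((J ∩ Set.Iio n).ncard : ℝ) / n) atTop (nhds a)

/-- Upper asymptotic density of a set of naturals. -/
noncomputable def upperDensity (J : Set ℕ) : ℝ :=
  limsup (fun n : ℕ => ((J ∩ Set.Iio n).ncard : ℝ) / n) atTop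

end Visits


namespace ShTfae

lemma FinChain.trans {X : Type*} [MetricSpace X] {f : X → X} {δ : ℝ} {n m : ℕ} {x y z : X}
    (h1 : FinChain f δ n x y) (h2 : FinChain f δ m y z) : FinChain f δ (n + m) x z := by
  obtain ⟨c, c0, cn, hc⟩ := h1
  obtain ⟨d, d0, dm, hd⟩ := h2
  refine ⟨fun i => if i < n then c i else d (i - n), ?_, ?_, ?_⟩
  · by_cases hn : 0 < n
    · simp [hn, c0]
    · have : n = 0 := by omega
      subst this
      simp [d0, ← cn, c0]
  · simp [dm]
  · intro i hi
    by_cases h : i + 1 < n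
    · have h' : i < n := by omega
      simp only [h, h', if_true]
      exact hc i h'
    · by_cases h' : i < n
      · have e : i + 1 = n := by omega
        have h3 := hc i h'
        simp only [h', if_true, e, lt_irrefl, if_false, Nat.sub_self, d0]
        rw [← cn, ← e]; exact h3
      · simp only [h, h', if_false]
        have e : i + 1 - n = (i - n) + 1 := by omega
        rw [e]
        exact hd _ (by omega)

lemma chain_end {X : Type*} [MetricSpace X] {f : X → X} {δ : ℝ} (hδ : 0 < δ) {n : ℕ}
    (hn : 0 < n) {x y : X} (h : dist (f^[n] x) y < δ) : FinChain f δ n x y := by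
  refine ⟨fun i => if i < n then f^[i] x else y, by simp [hn], by simp, ?_⟩
  intro i hi
  by_cases h' : i + 1 < n
  · simp only [hi, h', if_true, Function.iterate_succ_apply', dist_self]; exact hδ
  · have e : i + 1 = n := by omega
    simp only [hi, h', if_true, if_false]
    subst e
    rw [← Function.iterate_succ_apply' f i x]; exact h

lemma chain_orbit {X : Type*} [MetricSpace X] {f : X → X} {δ : ℝ} (hδ : 0 < δ) (n : ℕ)
    (x : X) : FinChain f δ n x (f^[n] x) :=
  ⟨fun i => f^[i] x, rfl, rfl, fun i _ => by
    simp only [Function.iterate_succ_apply', dist_self]; exact hδ⟩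

/-- chain `x, u, f u, …, y`. -/
lemma chain_start {X : Type*} [MetricSpace X] {f : X → X} {δ : ℝ} (hδ : 0 < δ) {n : ℕ}
    (hn : 0 < n) {x u y : X} (h0 : dist (f x) u < δ) (h : dist (f^[n] u) y < δ) :
    FinChain f δ (n + 1) x y := by
  have h1 : FinChain f δ 1 x u := chain_end hδ one_pos h0
  rw [add_comm]
  exact FinChain.trans h1 (chain_end hδ hn h)

lemma chain_mul {X : Type*} [MetricSpace X] {f : X → X} {δ : ℝ} (hδ : 0 < δ) {n : ℕ} {x : X}
    (h : FinChain f δ n x x) (k : ℕ) : FinChain f δ (k * n) x x := by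
  induction k with
  | zero => simpa using chain_orbit hδ 0 x
  | succ k ih => rw [Nat.succ_mul]; exact FinChain.trans ih h

lemma chainMixing_of {X : Type*} [MetricSpace X] {f : X → X}
    (h1 : ChainTransitive f)
    (h2 : ∀ δ : ℝ, 0 < δ → ∀ x : X, ∃ a b : ℕ, 0 < a ∧ 0 < b ∧ Nat.Coprime a b ∧
      FinChain f δ a x x ∧ FinChain f δ b x x) : ChainMixing f := by
  intro δ hδ x y
  obtain ⟨a, b, ha, hb, hab, ca, cb⟩ := h2 δ hδ x
  obtain ⟨n, hn, cn⟩ := h1 δ hδ x y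
  refine ⟨a * b + n, by positivity, fun m hm => ?_⟩
  have key : ∃ p q : ℕ, p * a + q * b = m - n := by
    refine Nat.exists_add_mul_eq_of_gcd_dvd_of_mul_pred_le a b (m - n) (by simp [hab.gcd_eq_one]) ?_
    have : a.pred * b.pred ≤ a * b := Nat.mul_le_mul (Nat.pred_le _) (Nat.pred_le _)
    omega
  obtain ⟨p, q, hpq⟩ := key
  have e : m = (p * a + q * b) + n := by omega
  rw [e]
  exact FinChain.trans (FinChain.trans (chain_mul hδ ca p) (chain_mul hδ cb q)) cn

lemma chainMixing_of' {X : Type*} [MetricSpace X] {f : X → X}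
    (h : ∀ δ : ℝ, 0 < δ → ∀ x x' y : X, ∃ n : ℕ, 0 < n ∧ FinChain f δ n x y ∧
      FinChain f δ n x' y) : ChainMixing f := by
  apply chainMixing_of
  · intro δ hδ x y
    obtain ⟨n, hn, h1, -⟩ := h δ hδ x x y
    exact ⟨n, hn, h1⟩
  · intro δ hδ x
    obtain ⟨n, hn, h1, h2⟩ := h δ hδ x (f x) x
    refine ⟨n, 1 + n, hn, by omega, by simp, h1, ?_⟩
    exact FinChain.trans (chain_orbit hδ 1 x) h2

lemma chainMixing_of_total {X : Type*} [MetricSpace X] {f : X → X}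
    (h : TotallyTransitive f) : ChainMixing f := by
  have key : ∀ δ : ℝ, 0 < δ → ∀ x y : X, ∀ k : ℕ, 1 ≤ k → ∃ m : ℕ, 0 < m ∧
      FinChain f δ (k * m + 1) x y := by
    intro δ hδ x y k hk
    obtain ⟨m, hm, v, ⟨u, hu, rfl⟩, hv⟩ := h k hk (ball (f x) δ) (ball y δ) isOpen_ball isOpen_ball
      ⟨_, mem_ball_self hδ⟩ ⟨_, mem_ball_self hδ⟩
    rw [← Function.iterate_mul] at hv
    exact ⟨m, hm, chain_start hδ (by positivity) (by rw [dist_comm]; exact hu) hv⟩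
  apply chainMixing_of
  · intro δ hδ x y
    obtain ⟨m, hm, c⟩ := key δ hδ x y 1 le_rfl
    exact ⟨_, by omega, c⟩
  · intro δ hδ x
    obtain ⟨m, hm, c⟩ := key δ hδ x x 1 le_rfl
    obtain ⟨m', hm', c'⟩ := key δ hδ x x (1 * m + 1) (by omega)
    exact ⟨_, _, by omega, by omega, by simp, c, c'⟩

lemma chainMixing_of_weak {X : Type*} [MetricSpace X] {f : X → X}
    (h : WeaklyMixing f) : ChainMixing f := by
  apply chainMixing_of'
  intro δ hδ x x' y
  obtain ⟨n, hn, v, ⟨u, hu, rfl⟩, hv⟩ := h (ball (f x) δ ×ˢ ball (f x') δ) (ball y δ ×ˢ ball y δ)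
    (isOpen_ball.prod isOpen_ball) (isOpen_ball.prod isOpen_ball)
    ⟨(f x, f x'), mem_ball_self hδ, mem_ball_self hδ⟩ ⟨(y, y), mem_ball_self hδ, mem_ball_self hδ⟩
  rw [Prod.map_iterate] at hv
  exact ⟨n + 1, by omega, chain_start hδ hn (by rw [dist_comm]; exact hu.1) hv.1,
    chain_start hδ hn (by rw [dist_comm]; exact hu.2) hv.2⟩

lemma topMixing_of_chainMixing {X : Type*} [MetricSpace X] {f : X → X}
    (hsh : Shadowing f) (h : ChainMixing f) : TopMixing f := by
  intro U V hU hV ⟨x, hx⟩ ⟨y, hy⟩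
  obtain ⟨e1, he1, h1⟩ := Metric.isOpen_iff.1 hU x hx
  obtain ⟨e2, he2, h2⟩ := Metric.isOpen_iff.1 hV y hy
  obtain ⟨δ, hδ, H⟩ := hsh (min e1 e2) (lt_min he1 he2)
  obtain ⟨N, hN, HN⟩ := h δ hδ x y
  refine ⟨N, hN, fun n hn => ?_⟩
  obtain ⟨c, c0, cn, hc⟩ := HN n hn
  obtain ⟨z, hz⟩ := H (fun i => if i < n then c i else f^[i - n] y) (by
    intro i
    by_cases h : i + 1 < n
    · have h' : i < n := by omega
      simp only [h, h', if_true]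
      exact hc i h'
    · by_cases h' : i < n
      · have e : i + 1 = n := by omega
        have h3 := hc i h'
        simp only [h', if_true, e, lt_irrefl, if_false, Nat.sub_self, Function.iterate_zero, id]
        rw [← cn, ← e]; exact h3
      · simp only [h, h', if_false]
        have e : i + 1 - n = (i - n) + 1 := by omega
        rw [e, Function.iterate_succ_apply', dist_self]
        exact hδ)
  refine ⟨f^[n] z, ⟨z, ?_, rfl⟩, ?_⟩
  · apply h1
    have := hz 0
    simp only [show 0 < n by omega, if_true, c0, Function.iterate_zero, id] at this
    exact this.trans_le (min_le_left _ _)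
  · apply h2
    have := hz n
    simp only [lt_irrefl, if_false, Nat.sub_self, Function.iterate_zero, id] at this
    exact this.trans_le (min_le_right _ _)

lemma total_of_mixing {X : Type*} [MetricSpace X] {f : X → X}
    (h : TopMixing f) : TotallyTransitive f := by
  intro n hn U V hU hV hU' hV'
  obtain ⟨N, hN, H⟩ := h U V hU hV hU' hV'
  refine ⟨N, hN, ?_⟩
  rw [← Function.iterate_mul]
  exact H _ (by nlinarith)

lemma weak_of_mixing {X : Type*} [MetricSpace X] {f : X → X}
    (h : TopMixing f) : WeaklyMixing f := by
  rintro U V hU hV ⟨⟨a, b⟩, hab⟩ ⟨⟨c, d⟩, hcd⟩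
  obtain ⟨U1, U2, o1, o2, m1, m2, s⟩ := isOpen_prod_iff.1 hU a b hab
  obtain ⟨V1, V2, p1, p2, n1, n2, s'⟩ := isOpen_prod_iff.1 hV c d hcd
  obtain ⟨N, hN, H⟩ := h U1 V1 o1 p1 ⟨_, m1⟩ ⟨_, n1⟩
  obtain ⟨N', hN', H'⟩ := h U2 V2 o2 p2 ⟨_, m2⟩ ⟨_, n2⟩
  refine ⟨N + N', by omega, ?_⟩
  obtain ⟨_, ⟨u, hu, rfl⟩, hv⟩ := H (N + N') (by omega)
  obtain ⟨_, ⟨u', hu', rfl⟩, hv'⟩ := H' (N + N') (by omega)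
  rw [Prod.map_iterate]
  exact ⟨_, ⟨(u, u'), s ⟨hu, hu'⟩, rfl⟩, s' ⟨hv, hv'⟩⟩

lemma surj_of_mixing {X : Type*} [MetricSpace X] [CompactSpace X] {f : X → X}
    (hf : Continuous f) (h : TopMixing f) : Function.Surjective f := by
  intro y
  by_contra hy
  obtain ⟨N, hN, H⟩ := h univ (range f)ᶜ isOpen_univ (isCompact_range hf).isClosed.isOpen_compl
    ⟨y, trivial⟩ ⟨y, hy⟩
  obtain ⟨_, ⟨u, -, rfl⟩, hv⟩ := H N le_rfl
  obtain ⟨k, rfl⟩ : ∃ k, N = k + 1 := ⟨N - 1, by omega⟩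
  exact hv ⟨f^[k] u, by rw [Function.iterate_succ_apply']⟩

/-- uniform chain mixing -/
lemma uniform_chain {X : Type*} [MetricSpace X] [CompactSpace X] {f : X → X}
    (h : TopMixing f) {δ : ℝ} (hδ : 0 < δ) :
    ∃ M : ℕ, ∀ n : ℕ, M ≤ n → ∀ u v : X, FinChain f δ n u v := by
  obtain ⟨t, -, ht⟩ := (isCompact_univ (X := X)).finite_cover_balls (half_pos hδ)
  obtain ⟨htf, hcov⟩ := ht
  choose N hN HN using fun p : X × X => h (ball p.1 (δ/2)) (ball p.2 (δ/2)) isOpen_ball isOpen_ball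
    ⟨_, mem_ball_self (half_pos hδ)⟩ ⟨_, mem_ball_self (half_pos hδ)⟩
  have hfin : (t ×ˢ t).Finite := htf.prod htf
  obtain ⟨B, hB⟩ := (hfin.image N).bddAbove
  refine ⟨B + 2, fun n hn u v => ?_⟩
  obtain ⟨a, ha, hua⟩ := mem_iUnion₂.1 (hcov (mem_univ (f u)))
  obtain ⟨b, hb, hvb⟩ := mem_iUnion₂.1 (hcov (mem_univ v))
  have hNB : N (a, b) ≤ B := hB ⟨(a, b), ⟨ha, hb⟩, rfl⟩
  obtain ⟨_, ⟨z, hz, rfl⟩, hz'⟩ := HN (a, b) (n - 1) (by omega)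
  have := chain_start (f := f) hδ (n := n - 1) (by omega) (x := u) (u := z) (y := v)
    (by
      have := dist_triangle_right (f u) z a
      simp only [mem_ball] at hua hz
      linarith)
    (by
      have := dist_triangle_right (f^[n-1] z) v b
      simp only [mem_ball] at hvb hz'
      linarith)
  rwa [show n - 1 + 1 = n by omega] at this

lemma exists_back {X : Type*} {f : X → X} (h : Function.Surjective f) (y : X) :
    ∃ yb : ℕ → X, yb 0 = y ∧ (∀ n, f (yb (n + 1)) = yb n) ∧
      ∀ m n, f^[m] (yb (n + m)) = yb n := by
  choose s hs using h
  have h1 : ∀ n, f (s^[n+1] y) = s^[n] y := fun n => by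
    rw [Function.iterate_succ_apply', hs]
  refine ⟨fun n => s^[n] y, rfl, h1, ?_⟩
  intro m
  induction m with
  | zero => intro n; rfl
  | succ m ih => intro n; rw [Function.iterate_succ_apply, ← add_assoc, h1, ih]

/-- splice -/
lemma splice {X : Type*} [MetricSpace X] {f : X → X} {δ : ℝ} (hδ : 0 < δ) {x z v : X}
    {i q r : ℕ} (hi : 0 < i) (hq : 0 < q)
    (h1 : dist (f^[i] x) z < δ) (h2 : dist (f^[q] z) v < δ) :
    FinChain f δ (i + q + r) x (f^[r] v) :=
  FinChain.trans (FinChain.trans (chain_end hδ hi h1) (chain_end hδ hq h2)) (chain_orbit hδ r v)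

lemma chainMixing_of_almostSpec {X : Type*} [MetricSpace X] {f : X → X}
    (hs : Function.Surjective f) (h : AlmostSpec f) : ChainMixing f := by
  obtain ⟨g, ε₀, kg, hg, hA⟩ := h
  apply chainMixing_of'
  have key : ∀ δ : ℝ, 0 < δ → ∃ n : ℕ, 0 < n ∧ ∀ x y : X, FinChain f δ n x y := by
    intro δ hδ
    have hsmall : Tendsto (fun n : ℕ => (g n δ : ℝ) / n) atTop (nhds 0) := by
      rcases le_or_gt δ ε₀ with h | h
      · exact hg.small δ hδ h
      · simp only [hg.ext _ _ h]; exact hg.small ε₀ hg.pos le_rfl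
    obtain ⟨n, hn1, hn2, hn3⟩ := ((hsmall.eventually (gt_mem_nhds (show (0:ℝ) < 1/2 by norm_num))).and
      ((eventually_ge_atTop (kg δ)).and (eventually_ge_atTop 4))).exists
    have hgn : 2 * g n δ < n := by
      have : (0:ℝ) < n := by exact_mod_cast (by omega : 0 < n)
      rw [div_lt_iff₀ this] at hn1
      have : (2 * g n δ : ℝ) < n := by linarith
      exact_mod_cast this
    refine ⟨n + n - 1, by omega, fun x y => ?_⟩
    obtain ⟨yb, yb0, -, yb2⟩ := exists_back hs y
    obtain ⟨z, hz⟩ := hA 2 (by norm_num) (fun _ => δ) (fun j => if j = 1 then x else yb (n - 1))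
      (fun _ => n) (fun _ _ _ => hδ) (fun _ _ _ => hn2)
    have ball : ∀ u v : X, u ∈ mistakeBowenBall f g n v δ → ∃ j, 0 < j ∧ j < n ∧
        dist (f^[j] v) (f^[j] u) < δ := by
      intro u v hu
      simp only [mistakeBowenBall, mem_iUnion] at hu
      obtain ⟨Λ, ⟨hΛ, hc⟩, hu⟩ := hu
      have : 1 < Λ.card := by omega
      obtain ⟨a, ha, hne⟩ := Finset.exists_mem_ne this 0
      exact ⟨a, by omega, by simpa using hΛ ha, hu a ha⟩
    obtain ⟨i, i0, hin, hi⟩ := ball _ _ (hz 1 le_rfl (by norm_num))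
    obtain ⟨j, j0, hjn, hj⟩ := ball _ _ (hz 2 (by norm_num) (by norm_num))
    simp at hi hj
    rw [← Function.iterate_add_apply] at hj
    have := splice (f := f) hδ (x := x) (z := f^[i] z) (v := f^[j] (yb (n-1))) (i := i)
      (q := j + n - i) (r := n - 1 - j) i0 (by omega) hi (by
        rw [← Function.iterate_add_apply, show j + n - i + i = j + n by omega, dist_comm]
        exact hj)
    rw [← Function.iterate_add_apply, show n - 1 - j + j = n - 1 by omega,
      show i + (j + n - i) + (n - 1 - j) = n + n - 1 by omega] at this
    have e := yb2 (n-1) 0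
    rw [zero_add, yb0] at e
    rwa [e] at this
  intro δ hδ x x' y
  obtain ⟨n, hn, h⟩ := key δ hδ
  exact ⟨n, hn, h _ _, h _ _⟩

lemma exists_diam (X : Type*) [MetricSpace X] [CompactSpace X] :
    ∃ D : ℝ, 0 < D ∧ ∀ x y : X, dist x y ≤ D := by
  refine ⟨Metric.diam (univ : Set X) + 1, by positivity, fun x y => ?_⟩
  have := Metric.dist_le_diam_of_mem (isCompact_univ (X := X)).isBounded (mem_univ x) (mem_univ y)
  linarith

lemma tendsto_log_div (D : ℝ) :
    Tendsto (fun n : ℕ => D * ((Nat.log 2 n : ℝ) + 1) / n) atTop (nhds 0) := by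
  have h1 : Tendsto (fun n : ℕ => Real.log n / n) atTop (nhds 0) := by
    have := (Real.isLittleO_log_id_atTop.tendsto_div_nhds_zero).comp
      (tendsto_natCast_atTop_atTop (R := ℝ))
    exact this
  have h2 : Tendsto (fun n : ℕ => (Nat.log 2 n : ℝ) / n) atTop (nhds 0) := by
    have h3 := h1.const_mul (1 / Real.log 2)
    rw [mul_zero] at h3
    refine squeeze_zero (fun n => by positivity) (fun n => ?_) h3
    have := Real.natLog_le_logb n 2
    rw [Real.logb] at this
    push_cast at this
    calc (Nat.log 2 n : ℝ) / n ≤ (Real.log n / Real.log 2) / n := by gcongr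
      _ = _ := by ring
  have h4 : Tendsto (fun n : ℕ => (1 : ℝ) / n) atTop (nhds 0) := tendsto_one_div_atTop_nhds_zero_nat
  have := (h2.add h4).const_mul D
  simp only [add_zero, mul_zero] at this
  refine this.congr fun n => by ring

lemma log_block {k r : ℕ} (hr : r < 2 ^ k) : Nat.log 2 (2 ^ k + r) = k := by
  apply Nat.log_eq_of_pow_le_of_lt_pow <;> [omega; (rw [pow_succ]; omega)]

lemma aasp_chain {X : Type*} [MetricSpace X] [CompactSpace X] {f : X → X}
    (hs : Function.Surjective f) (h : AsympAvgShadowing f) {δ : ℝ} (hδ : 0 < δ) (x y : X) :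
    ∀ᶠ k : ℕ in atTop, FinChain f δ (2 ^ (2 * k + 2) - 1 - 2 ^ (2 * k)) x y := by
  obtain ⟨D, hD, hdist⟩ := exists_diam X
  obtain ⟨yb, yb0, yb1, yb2⟩ := exists_back hs y
  set w : ℕ → X := fun i => if Even (Nat.log 2 i) then f^[i - 2 ^ (Nat.log 2 i)] x
    else yb (2 ^ (Nat.log 2 i + 1) - 1 - i) with hw
  have hwe : ∀ k r, Even k → r < 2 ^ k → w (2 ^ k + r) = f^[r] x := by
    intro k r hk hr
    simp only [hw, log_block hr, hk, if_true]
    congr 2; omega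
  have hwo : ∀ k r, ¬ Even k → r < 2 ^ k → w (2 ^ k + r) = yb (2 ^ k - 1 - r) := by
    intro k r hk hr
    simp only [hw, log_block hr, hk, if_false]
    congr 1; rw [pow_succ]; omega
  have hstep : ∀ i, i ≠ 0 → i + 1 ≠ 2 ^ (Nat.log 2 i + 1) → f (w i) = w (i + 1) := by
    intro i hi h1
    have h2 : 2 ^ (Nat.log 2 i) ≤ i := Nat.pow_log_le_self 2 hi
    have h3 : i < 2 ^ (Nat.log 2 i + 1) := Nat.lt_pow_succ_log_self (by norm_num) i
    generalize Nat.log 2 i = k at *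
    obtain ⟨r, rfl⟩ := Nat.exists_eq_add_of_le h2
    rw [pow_succ] at h1 h3
    have hr : r + 1 < 2 ^ k := by omega
    rw [add_assoc]
    by_cases hk : Even k
    · rw [hwe k r hk (by omega), hwe k (r+1) hk hr, Function.iterate_succ_apply']
    · rw [hwo k r hk (by omega), hwo k (r+1) hk hr, ← yb1 (2 ^ k - 1 - (r + 1))]
      congr 2; omega
  have hsum : ∀ T : ℕ, ∑ i ∈ Finset.range T, dist (f (w i)) (w (i + 1)) ≤
      D * ((Nat.log 2 T : ℝ) + 1) := by
    intro T
    induction T with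
    | zero => simp; exact hD.le
    | succ T ih =>
      rw [Finset.sum_range_succ]
      rcases Nat.eq_zero_or_pos T with rfl | hT
      · simp; exact hdist _ _
      · by_cases h1 : T + 1 = 2 ^ (Nat.log 2 T + 1)
        · have : Nat.log 2 (T + 1) = Nat.log 2 T + 1 := by
            conv_lhs => rw [h1]
            exact Nat.log_pow (by norm_num) _
          rw [this]; push_cast
          have := hdist (f (w T)) (w (T+1))
          linarith
        · rw [hstep T (by omega) h1, dist_self, add_zero]
          refine ih.trans ?_
          have : Nat.log 2 T ≤ Nat.log 2 (T + 1) := Nat.log_mono_right (by omega)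
          gcongr
  obtain ⟨z, hz⟩ := h w (by
    refine squeeze_zero (fun n => by positivity) (fun n => ?_) (tendsto_log_div D)
    gcongr; exact hsum n)
  have hev := hz.eventually (gt_mem_nhds (show (0:ℝ) < δ / 4 by positivity))
  obtain ⟨T0, hT0⟩ := eventually_atTop.1 hev
  have hit : ∀ k, T0 ≤ k → 1 ≤ k → ∃ r, 0 < r ∧ r < 2 ^ k ∧ dist (f^[2 ^ k + r] z) (w (2 ^ k + r)) < δ := by
    intro k hk hk1
    by_contra! hcon
    have h1 := hT0 (2 ^ (k + 1)) (by have := Nat.lt_two_pow_self (n := k + 1); omega)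
    rw [div_lt_iff₀ (by positivity)] at h1
    have h2 : ∑ r ∈ Finset.Ico 1 (2 ^ k), δ ≤ ∑ i ∈ Finset.range (2 ^ (k+1)), dist (f^[i] z) (w i) := by
      calc ∑ r ∈ Finset.Ico 1 (2 ^ k), δ
          ≤ ∑ r ∈ Finset.Ico 1 (2 ^ k), dist (f^[2 ^ k + r] z) (w (2 ^ k + r)) := by
            apply Finset.sum_le_sum
            intro r hr
            rw [Finset.mem_Ico] at hr
            exact hcon r (by omega) hr.2
        _ = ∑ i ∈ Finset.Ico (2 ^ k + 1) (2 ^ k + 2 ^ k), dist (f^[i] z) (w i) := by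
            rw [Finset.sum_Ico_add (fun i => dist (f^[i] z) (w i)) 1 (2 ^ k) (2 ^ k)]
            rw [add_comm 1]
        _ ≤ _ := by
            apply Finset.sum_le_sum_of_subset_of_nonneg
            · intro i hi
              rw [Finset.mem_Ico] at hi
              rw [Finset.mem_range, pow_succ]; omega
            · intros; positivity
    rw [Finset.sum_const, Nat.card_Ico, nsmul_eq_mul, Nat.cast_sub Nat.one_le_two_pow] at h2
    push_cast at h1 h2
    have h4 : (2:ℝ) ^ (k + 1) = 2 * 2 ^ k := by rw [pow_succ]; ring
    rw [h4] at h1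
    have h3 : (2:ℝ) ≤ 2 ^ k := by
      calc (2:ℝ) = 2 ^ 1 := by norm_num
        _ ≤ 2 ^ k := pow_le_pow_right₀ (by norm_num) hk1
    nlinarith
  filter_upwards [eventually_ge_atTop (T0 + 1)] with k hk
  obtain ⟨r, r0, hr, h1⟩ := hit (2 * k) (by omega) (by omega)
  obtain ⟨q, q0, hq, h2⟩ := hit (2 * k + 1) (by omega) (by omega)
  rw [hwe _ _ (by simp) hr] at h1
  rw [hwo _ _ (by simp) hq] at h2
  have e1 : 2 ^ (2 * k + 1) = 2 * 2 ^ (2 * k) := by rw [pow_succ]; ring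
  have e2 : 2 ^ (2 * k + 2) = 4 * 2 ^ (2 * k) := by rw [pow_add]; ring
  rw [e1] at h2 hq
  rw [e2]
  generalize 2 ^ (2 * k) = m at *
  have := splice (f := f) hδ (x := x) (z := f^[m + r] z) (v := yb (2 * m - 1 - q)) (i := r)
      (q := m + q - r) (r := 2 * m - 1 - q) r0 (by omega) (by rwa [dist_comm]) (by
        rw [← Function.iterate_add_apply, show m + q - r + (m + r) = 2 * m + q by omega]
        exact h2)
  have e := yb2 (2 * m - 1 - q) 0
  rw [zero_add, yb0] at e
  rw [e] at this
  convert this using 1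
  omega

lemma chainMixing_of_aasp {X : Type*} [MetricSpace X] [CompactSpace X] {f : X → X}
    (hs : Function.Surjective f) (h : AsympAvgShadowing f) : ChainMixing f := by
  apply chainMixing_of'
  intro δ hδ x x' y
  obtain ⟨k, h1, h2⟩ := ((aasp_chain hs h hδ x y).and (aasp_chain hs h hδ x' y)).exists
  refine ⟨_, ?_, h1, h2⟩
  have e2 : 2 ^ (2 * k + 2) = 4 * 2 ^ (2 * k) := by rw [pow_add]; ring
  have := Nat.one_le_two_pow (n := 2 * k)
  omega

lemma sum_dvd (n : ℕ) (k T : ℕ) :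
    (∑ i ∈ Finset.range T, if n ∣ i + k + 1 then 1 else 0) + k / n = (k + T) / n := by
  induction T with
  | zero => simp
  | succ T ih =>
    rw [Finset.sum_range_succ, ← add_assoc k T 1, Nat.succ_div, ← ih, add_comm T k]
    omega

lemma asp_chain {X : Type*} [MetricSpace X] [CompactSpace X] {f : X → X}
    (hs : Function.Surjective f) (h : AvgShadowing f) {η : ℝ} (hη : 0 < η) :
    ∃ n : ℕ, 0 < n ∧ ∀ x y : X, FinChain f η n x y := by
  obtain ⟨D, hD, hdist⟩ := exists_diam X
  obtain ⟨δ, hδ, H⟩ := h (η / 4) (by positivity)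
  obtain ⟨n0, hn0⟩ := exists_nat_gt (2 * D / δ)
  obtain ⟨n, hnn, hn2⟩ : ∃ n, n0 ≤ n ∧ 2 ≤ n := ⟨n0 + 2, by omega, by omega⟩
  have hnpos : (0:ℝ) < n := by exact_mod_cast (by omega : 0 < n)
  have hn : 2 * D < δ * n := by
    rw [div_lt_iff₀ hδ] at hn0
    have : (n0:ℝ) ≤ n := by exact_mod_cast hnn
    nlinarith
  refine ⟨2 * n - 1, by omega, fun x y => ?_⟩
  obtain ⟨yb, yb0, yb1, yb2⟩ := exists_back hs y
  set w : ℕ → X := fun i => if i % (2 * n) < n then f^[i % (2 * n)] x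
    else yb (2 * n - 1 - i % (2 * n)) with hw
  have hw1 : ∀ m r, r < n → w (m * (2 * n) + r) = f^[r] x := by
    intro m r hr
    have : (m * (2 * n) + r) % (2 * n) = r := by
      rw [Nat.mul_add_mod', Nat.mod_eq_of_lt]; omega
    simp only [hw, this, hr, if_true]
  have hw2 : ∀ m r, r < n → w (m * (2 * n) + n + r) = yb (n - 1 - r) := by
    intro m r hr
    have : (m * (2 * n) + n + r) % (2 * n) = n + r := by
      rw [add_assoc, Nat.mul_add_mod', Nat.mod_eq_of_lt]; omega
    simp only [hw, this, show ¬ (n + r < n) by omega, if_false]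
    congr 1; omega
  have hstep : ∀ i, ¬ n ∣ i + 1 → f (w i) = w (i + 1) := by
    intro i hi
    have e := Nat.div_add_mod i (2 * n)
    have hlt := Nat.mod_lt i (show 0 < 2 * n by omega)
    generalize i % (2 * n) = r at *
    generalize i / (2 * n) = m at *
    rw [mul_comm] at e
    subst e
    by_cases hr : r < n
    · have : r + 1 ≠ n := by
        intro h; apply hi
        rw [add_assoc, h]
        exact Dvd.dvd.add (Dvd.dvd.mul_left (Dvd.intro_left _ rfl) _) dvd_rfl
      rw [hw1 m r hr, add_assoc, hw1 m (r+1) (by omega), Function.iterate_succ_apply']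
    · obtain ⟨q, rfl⟩ := Nat.exists_eq_add_of_le (not_lt.1 hr)
      have : q + 1 ≠ n := by
        intro h; apply hi
        rw [add_assoc, add_assoc, h]
        exact Dvd.dvd.add (Dvd.dvd.mul_left (Dvd.intro_left _ rfl) _) (Dvd.dvd.add dvd_rfl dvd_rfl)
      rw [← add_assoc, hw2 m q (by omega), add_assoc _ q 1, hw2 m (q+1) (by omega), ← yb1 (n - 1 - (q + 1))]
      congr 2; omega
  obtain ⟨z, hz⟩ := H w ⟨n, by omega, by
    intro T hT k
    have hTpos : (0:ℝ) < T := by exact_mod_cast (by omega : 0 < T)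
    rw [div_lt_iff₀ hTpos]
    have h1 : ∑ i ∈ Finset.range T, dist (f (w (i + k))) (w (i + k + 1)) ≤
        D * ((∑ i ∈ Finset.range T, if n ∣ i + k + 1 then 1 else 0 : ℕ) : ℝ) := by
      push_cast
      rw [Finset.mul_sum]
      apply Finset.sum_le_sum
      intro i _
      split_ifs with hd
      · simpa using hdist _ _
      · rw [hstep _ hd]; simp
    have h2 := sum_dvd n k T
    have h3 : (k + T) / n ≤ k / n + T / n + 1 := by
      rw [Nat.add_div (by omega)]; split_ifs <;> omega
    have h4 : (∑ i ∈ Finset.range T, if n ∣ i + k + 1 then 1 else 0 : ℕ) ≤ T / n + 1 := by omega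
    have h5 : n * (T / n + 1) ≤ 2 * T := by
      have := Nat.mul_div_le T n
      rw [Nat.mul_add]; omega
    have h6 : ((∑ i ∈ Finset.range T, if n ∣ i + k + 1 then 1 else 0 : ℕ) : ℝ) ≤ ((T / n + 1 : ℕ) : ℝ) := by
      exact_mod_cast h4
    have h7 : (n : ℝ) * ((T / n + 1 : ℕ) : ℝ) ≤ 2 * T := by exact_mod_cast h5
    have h8 := h1.trans (mul_le_mul_of_nonneg_left h6 hD.le)
    refine h8.trans_lt ?_
    have h9 : D * ((T / n + 1 : ℕ) : ℝ) * n < δ * T * n := by nlinarith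
    exact lt_of_mul_lt_mul_right h9 hnpos.le⟩
  have hit : ∃ m, (∃ r, 0 < r ∧ r < n ∧ dist (f^[m * (2 * n) + r] z) (w (m * (2 * n) + r)) < η) ∧
      (∃ r, r < n ∧ dist (f^[m * (2 * n) + n + r] z) (w (m * (2 * n) + n + r)) < η) := by
    by_contra! hcon
    set e : ℕ → ℝ := fun i => dist (f^[i] z) (w i) with he
    have e0 : ∀ i, 0 ≤ e i := fun i => dist_nonneg
    have hper : ∀ m, η * (n - 1) ≤ ∑ r ∈ Finset.range (2 * n), e (m * (2 * n) + r) := by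
      intro m
      rw [two_mul n, Finset.sum_range_add, ← two_mul n]
      have s1 : 0 ≤ ∑ r ∈ Finset.range n, e (m * (2 * n) + r) := Finset.sum_nonneg fun _ _ => e0 _
      have s2 : 0 ≤ ∑ r ∈ Finset.range n, e (m * (2 * n) + (n + r)) :=
        Finset.sum_nonneg fun _ _ => e0 _
      by_cases hc : ∃ r, 0 < r ∧ r < n ∧ e (m * (2 * n) + r) < η
      · have := hcon m hc
        have s3 : ∑ r ∈ Finset.range n, η ≤ ∑ r ∈ Finset.range n, e (m * (2 * n) + (n + r)) := by
          apply Finset.sum_le_sum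
          intro r hr
          rw [← add_assoc]
          exact this r (Finset.mem_range.1 hr)
        rw [Finset.sum_const, Finset.card_range, nsmul_eq_mul] at s3
        nlinarith
      · push Not at hc
        have s3 : ∑ r ∈ Finset.Ico 1 n, η ≤ ∑ r ∈ Finset.range n, e (m * (2 * n) + r) := by
          refine (Finset.sum_le_sum (g := fun r => e (m * (2 * n) + r)) ?_).trans
            (Finset.sum_le_sum_of_subset_of_nonneg ?_ fun _ _ _ => e0 _)
          · intro r hr
            rw [Finset.mem_Ico] at hr
            exact hc r (by omega) hr.2
          · intro i hi
            rw [Finset.mem_Ico] at hi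
            rw [Finset.mem_range]; omega
        rw [Finset.sum_const, Nat.card_Ico, nsmul_eq_mul, Nat.cast_sub (by omega)] at s3
        push_cast at s3
        nlinarith
    have htot : ∀ m : ℕ, m * (η * (n - 1)) ≤ ∑ i ∈ Finset.range (m * (2 * n)), e i := by
      intro m
      induction m with
      | zero => simp
      | succ m ih =>
        rw [Nat.succ_mul, Finset.sum_range_add]
        have := hper m
        push_cast
        linarith
    have : η / 4 ≤ limsup (fun n : ℕ => (∑ i ∈ Finset.range n, dist (f^[i] z) (w i)) / n) atTop := by
      apply le_limsup_of_frequently_le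
      · rw [frequently_atTop]
        intro a
        refine ⟨(a + 1) * (2 * n), by nlinarith, ?_⟩
        rw [le_div_iff₀ (by positivity)]
        refine le_trans ?_ (htot (a + 1))
        have : (2:ℝ) ≤ n := by exact_mod_cast hn2
        push_cast
        have : 0 ≤ (a + 1 : ℝ) * η := by positivity
        nlinarith
      · refine ⟨D, ?_⟩
        simp only [eventually_map]
        filter_upwards [eventually_gt_atTop 0] with T hT
        have hTpos : (0:ℝ) < T := by exact_mod_cast hT
        rw [div_le_iff₀ hTpos]
        calc _ ≤ ∑ i ∈ Finset.range T, D := Finset.sum_le_sum fun _ _ => hdist _ _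
          _ = D * T := by simp [mul_comm]
    exact absurd hz (not_lt.2 this)
  obtain ⟨m, ⟨r, r0, hr, h1⟩, q, hq, h2⟩ := hit
  rw [hw1 _ _ hr] at h1
  rw [hw2 _ _ hq] at h2
  generalize m * (2 * n) = a at *
  have := splice (f := f) hη (x := x) (z := f^[a + r] z) (v := yb (n - 1 - q)) (i := r)
      (q := n + q - r) (r := n - 1 - q) r0 (by omega) (by rwa [dist_comm]) (by
        rw [← Function.iterate_add_apply, show n + q - r + (a + r) = a + n + q by omega]
        exact h2)
  have e := yb2 (n - 1 - q) 0
  rw [zero_add, yb0] at e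
  rw [e] at this
  convert this using 1
  omega

lemma chainMixing_of_asp {X : Type*} [MetricSpace X] [CompactSpace X] {f : X → X}
    (hs : Function.Surjective f) (h : AvgShadowing f) : ChainMixing f := by
  apply chainMixing_of'
  intro δ hδ x x' y
  obtain ⟨n, hn, h⟩ := asp_chain hs h hδ
  exact ⟨n, hn, h _ _, h _ _⟩

lemma block_exists {n : ℕ → ℕ} (hn : ∀ j, 0 < n j) (i : ℕ) :
    ∃ j k, k < n j ∧ i = (∑ r ∈ Finset.range j, n r) + k := by
  induction i with
  | zero => exact ⟨0, 0, hn 0, by simp⟩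
  | succ i ih =>
    obtain ⟨j, k, hk, e⟩ := ih
    by_cases h : k + 1 < n j
    · exact ⟨j, k + 1, h, by omega⟩
    · exact ⟨j + 1, 0, hn _, by rw [Finset.sum_range_succ]; omega⟩

lemma block_mono (n : ℕ → ℕ) {j j' : ℕ} (h : j < j') :
    (∑ r ∈ Finset.range j, n r) + n j ≤ ∑ r ∈ Finset.range j', n r := by
  rw [← Finset.sum_range_succ]
  exact Finset.sum_le_sum_of_subset (Finset.range_subset_range.2 h)

lemma block_unique {n : ℕ → ℕ} {j k j' k' : ℕ} (hk : k < n j) (hk' : k' < n j')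
    (e : (∑ r ∈ Finset.range j, n r) + k = (∑ r ∈ Finset.range j', n r) + k') :
    j = j' ∧ k = k' := by
  have : j = j' := by
    rcases lt_trichotomy j j' with h | h | h
    · have := block_mono n h; omega
    · exact h
    · have := block_mono n h; omega
  subst this
  exact ⟨rfl, by omega⟩

lemma glue {Y : Type*} {n : ℕ → ℕ} (hn : ∀ j, 0 < n j) (W : ℕ → ℕ → Y) :
    ∃ w : ℕ → Y, ∀ j k, k < n j → w ((∑ r ∈ Finset.range j, n r) + k) = W j k := by
  choose J K hK e using block_exists hn
  refine ⟨fun i => W (J i) (K i), fun j k hk => ?_⟩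
  obtain ⟨h1, h2⟩ := block_unique hk (hK _) (e ((∑ r ∈ Finset.range j, n r) + k))
  simp only [← h1, ← h2]

open Classical in
lemma piecewise {X : Type*} [MetricSpace X] {f : X → X} {δ ε : ℝ} (hδ : 0 < δ)
    (H : ∀ x : ℕ → X, PseudoOrbit f δ x → ∃ z : X, ∀ i : ℕ, dist (f^[i] z) (x i) < ε)
    (w : ℕ → X) (B : Set ℕ) (hw : ∀ i, i + 1 ∉ B → dist (f (w i)) (w (i + 1)) < δ) :
    ∃ v : ℕ → X, (∀ i, dist (v i) (w i) < ε) ∧ ∀ i, i + 1 ∉ B → v (i + 1) = f (v i) := by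
  let P : ℕ → ℕ → Prop := fun b k => ∀ m, b < m → m ≤ b + k → m ∉ B
  let c : ℕ → ℕ → X := fun b k => Nat.rec (w b)
    (fun k p => if P b (k + 1) then w (b + (k + 1)) else f p) k
  have c0 : ∀ b, c b 0 = w b := fun b => rfl
  have cs : ∀ b k, c b (k + 1) = if P b (k + 1) then w (b + (k + 1)) else f (c b k) :=
    fun b k => rfl
  have cP : ∀ b k, P b k → c b k = w (b + k) := by
    intro b k h
    cases k with
    | zero => rfl
    | succ k => rw [cs, if_pos h]
  have cpo : ∀ b, PseudoOrbit f δ (c b) := by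
    intro b k
    rw [cs]
    split_ifs with h
    · rw [cP b k (fun m h1 h2 => h m h1 (by omega))]
      exact hw _ (h _ (by omega) (by omega))
    · rw [dist_self]; exact hδ
  choose z hz using fun b => H (c b) (cpo b)
  let st : ℕ → ℕ := fun i => Nat.rec 0 (fun i p => if i + 1 ∈ B then i + 1 else p) i
  have sts : ∀ i, st (i + 1) = if i + 1 ∈ B then i + 1 else st i := fun i => rfl
  have stle : ∀ i, st i ≤ i := by
    intro i
    induction i with
    | zero => exact le_rfl
    | succ i ih => rw [sts]; split_ifs <;> omega
  have stP : ∀ i, ∀ m, st i < m → m ≤ i → m ∉ B := by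
    intro i
    induction i with
    | zero => intro m h1 h2; omega
    | succ i ih =>
      intro m h1 h2
      rw [sts] at h1
      split_ifs at h1 with h
      · omega
      · rcases Nat.lt_or_ge m (i + 1) with h3 | h3
        · exact ih m h1 (by omega)
        · rw [show m = i + 1 by omega]; exact h
  refine ⟨fun i => f^[i - st i] (z (st i)), fun i => ?_, fun i hi => ?_⟩
  · have h1 := hz (st i) (i - st i)
    have h2 := stle i
    rw [cP _ _ (fun m h1 h2 => stP i m h1 (by omega)), show st i + (i - st i) = i by omega] at h1
    exact h1
  · simp only [sts, hi, if_false]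
    have h2 := stle i
    rw [show i + 1 - st i = (i - st i) + 1 by omega, Function.iterate_succ_apply']

def Stage {X : Type*} [MetricSpace X] (f : X → X) (M : ℕ → ℕ) (e : ℕ → ℝ) (n s : ℕ → ℕ)
    (x : ℕ → X) (t : ℕ) (w : ℕ → X) : Prop :=
  (∀ j, t ≤ s j → ∀ k, k < n j → w ((∑ r ∈ Finset.range j, n r) + k) = f^[k] (x j)) ∧
  (∀ j, s j < t → ∀ k, M (s j) ≤ k → k + M (s j) < n j →
    dist (w ((∑ r ∈ Finset.range j, n r) + k)) (f^[k] (x j)) < ∑ r ∈ Finset.Ico (s j) t, e r) ∧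
  (∀ j k, k + 1 < n j → w ((∑ r ∈ Finset.range j, n r) + (k + 1)) =
    f (w ((∑ r ∈ Finset.range j, n r) + k))) ∧
  (∀ j, s j < t → s (j + 1) < t → w ((∑ r ∈ Finset.range j, n r) + n j) =
    f (w ((∑ r ∈ Finset.range j, n r) + (n j - 1))))

open Classical in
lemma stage_step {X : Type*} [MetricSpace X] {f : X → X} {M : ℕ → ℕ} {e : ℕ → ℝ} {n s : ℕ → ℕ}
    {x : ℕ → X} {t : ℕ} {w : ℕ → X} {δ : ℝ} (hδ : 0 < δ)
    (H : ∀ x : ℕ → X, PseudoOrbit f δ x → ∃ z : X, ∀ i : ℕ, dist (f^[i] z) (x i) < e t)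
    (hM : 1 ≤ M t) (hC : ∀ m, M t ≤ m → ∀ u v : X, FinChain f δ m u v)
    (hn : ∀ j, 2 * M (s j) + 1 ≤ n j)
    (hst : Stage f M e n s x t w) : ∃ w', Stage f M e n s x (t + 1) w' := by
  obtain ⟨ha, hb, hc, hd⟩ := hst
  have hn0 : ∀ j, 0 < n j := fun j => by have := hn j; omega
  set l : ℕ → ℕ := fun j => ∑ r ∈ Finset.range j, n r with hl
  have ls : ∀ j, l (j + 1) = l j + n j := fun j => Finset.sum_range_succ _ _
  change ∀ j, t ≤ s j → ∀ k, k < n j → w (l j + k) = f^[k] (x j) at ha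
  change ∀ j, s j < t → ∀ k, M (s j) ≤ k → k + M (s j) < n j →
    dist (w (l j + k)) (f^[k] (x j)) < ∑ r ∈ Finset.Ico (s j) t, e r at hb
  change ∀ j k, k + 1 < n j → w (l j + (k + 1)) = f (w (l j + k)) at hc
  change ∀ j, s j < t → s (j + 1) < t → w (l j + n j) = f (w (l j + (n j - 1))) at hd
  choose C1 C1a C1b C1c using hC (M t + 1) (by omega)
  choose C2 C2a C2b C2c using hC (M t) le_rfl
  let cS : ℕ → ℕ → X := fun j => C1 (w (l j - 1)) (w (l j + M t))
  let cE : ℕ → ℕ → X := fun j => C2 (w (l j + (n j - M t))) (w (l j + n j))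
  obtain ⟨W, hW⟩ := glue hn0 (fun j k => if s j = t then
    (if k < M t then cS j (k + 1) else
      if n j - M t ≤ k ∧ s (j + 1) < t then cE j (k - (n j - M t)) else w (l j + k))
    else w (l j + k))
  change ∀ j k, k < n j → W (l j + k) = _ at hW
  -- values
  have V1 : ∀ j k, k < n j → s j ≠ t → W (l j + k) = w (l j + k) := by
    intro j k hk h; rw [hW j k hk, if_neg h]
  have V2 : ∀ j k, k < n j → s j = t → k < M t → W (l j + k) = cS j (k + 1) := by
    intro j k hk h h'; rw [hW j k hk, if_pos h, if_pos h']
  have V3 : ∀ j k, k < n j → s j = t → M t ≤ k → n j - M t ≤ k → s (j + 1) < t →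
      W (l j + k) = cE j (k - (n j - M t)) := by
    intro j k hk h h1 h2 h3
    rw [hW j k hk, if_pos h, if_neg (by omega), if_pos ⟨h2, h3⟩]
  have V4 : ∀ j k, k < n j → s j = t → M t ≤ k → ¬ (n j - M t ≤ k ∧ s (j + 1) < t) →
      W (l j + k) = w (l j + k) := by
    intro j k hk h h1 h2
    rw [hW j k hk, if_pos h, if_neg (by omega), if_neg h2]
  -- jumps inside a block
  have J1 : ∀ j k, k + 1 < n j → dist (f (W (l j + k))) (W (l j + (k + 1))) < δ := by
    intro j k hk
    by_cases h : s j = t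
    · have hnj := hn j
      rw [h] at hnj
      by_cases h1 : k + 1 < M t
      · rw [V2 j k (by omega) h (by omega), V2 j (k+1) hk h h1]
        exact C1c _ _ _ (by omega)
      · by_cases h2 : k + 1 = M t
        · rw [V2 j k (by omega) h (by omega), V4 j (k+1) hk h (by omega) (by omega)]
          have := C1c (w (l j - 1)) (w (l j + M t)) (k + 1) (by omega)
          rw [show k + 1 + 1 = M t + 1 by omega, C1b] at this
          rw [h2]
          rw [h2] at this
          exact this
        · by_cases h3 : n j - M t ≤ k ∧ s (j + 1) < t
          · rw [V3 j k (by omega) h (by omega) h3.1 h3.2, V3 j (k+1) hk h (by omega) (by omega) h3.2,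
              show k + 1 - (n j - M t) = (k - (n j - M t)) + 1 by omega]
            exact C2c _ _ _ (by omega)
          · rw [V4 j k (by omega) h (by omega) h3]
            by_cases h4 : n j - M t ≤ k + 1 ∧ s (j + 1) < t
            · have h5 : k + 1 = n j - M t := by
                rcases h4 with ⟨h4, h6⟩
                have : ¬ (n j - M t ≤ k) := fun h => h3 ⟨h, h6⟩
                omega
              rw [V3 j (k+1) hk h (by omega) h4.1 h4.2]
              show dist _ (C2 _ _ _) < δ
              rw [show k + 1 - (n j - M t) = 0 by omega, C2a, ← h5, hc j k hk, dist_self]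
              exact hδ
            · rw [V4 j (k+1) hk h (by omega) h4, hc j k hk, dist_self]
              exact hδ
    · rw [V1 j k (by omega) h, V1 j (k+1) hk h, hc j k hk, dist_self]
      exact hδ
  -- jumps at boundaries
  have J2 : ∀ j, s j ≤ t → s (j + 1) ≤ t →
      dist (f (W (l j + (n j - 1)))) (W (l (j + 1) + 0)) < δ := by
    intro j h1 h2
    have hnj := hn j
    have e1 : l (j + 1) - 1 = l j + (n j - 1) := by have := hn0 j; rw [ls]; omega
    by_cases h3 : s (j + 1) = t
    · rw [V2 (j+1) 0 (hn0 _) h3 (by omega)]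
      have e2 : W (l j + (n j - 1)) = w (l j + (n j - 1)) := by
        by_cases h4 : s j = t
        · rw [h4] at hnj
          exact V4 j _ (by omega) h4 (by omega) (by omega)
        · exact V1 j _ (by omega) h4
      rw [e2, ← e1]
      have := C1c (w (l (j+1) - 1)) (w (l (j+1) + M t)) 0 (by omega)
      rw [C1a] at this
      exact this
    · have h5 : s (j + 1) < t := by omega
      rw [V1 (j+1) 0 (hn0 _) h3, add_zero, ls]
      by_cases h4 : s j = t
      · rw [h4] at hnj
        rw [V3 j (n j - 1) (by omega) h4 (by omega) (by omega) h5]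
        have := C2c (w (l j + (n j - M t))) (w (l j + n j)) (M t - 1) (by omega)
        rw [show M t - 1 + 1 = M t by omega, C2b] at this
        rw [show n j - 1 - (n j - M t) = M t - 1 by omega]
        exact this
      · rw [V1 j _ (by omega) h4, hd j (by omega) h5, dist_self]
        exact hδ
  -- the set of remaining boundaries
  let B : Set ℕ := {i | ∃ j, i = l (j + 1) ∧ (t < s j ∨ t < s (j + 1))}
  have hB1 : ∀ j k, k + 1 < n j → l j + (k + 1) ∉ B := by
    rintro j k hk ⟨j', h1, -⟩
    have := block_unique (n := n) (j := j) (k := k + 1) (j' := j' + 1) (k' := 0) hk (hn0 _) h1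
    omega
  have hB2 : ∀ j, l (j + 1) ∉ B ↔ s j ≤ t ∧ s (j + 1) ≤ t := by
    intro j
    constructor
    · intro h
      by_contra h'
      exact h ⟨j, rfl, by omega⟩
    · rintro h ⟨j', h1, h2⟩
      have := block_unique (n := n) (j := j + 1) (k := 0) (j' := j' + 1) (k' := 0) (hn0 _) (hn0 _) h1
      have : j = j' := by omega
      subst this
      omega
  obtain ⟨v, hv1, hv2⟩ := piecewise hδ H W B (by
    intro i hi
    obtain ⟨j, k, hk, rfl⟩ := block_exists hn0 i
    change l j + k + 1 ∉ B at hi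
    change dist (f (W (l j + k))) (W (l j + k + 1)) < δ
    by_cases h : k + 1 < n j
    · exact J1 j k h
    · have e1 : l j + k + 1 = l (j + 1) := by rw [ls]; omega
      rw [e1] at hi ⊢
      rw [hB2] at hi
      rw [show k = n j - 1 by omega]
      exact J2 j hi.1 hi.2)
  obtain ⟨u, hu⟩ := glue hn0 (fun j k => if t < s j then w (l j + k) else v (l j + k))
  change ∀ j k, k < n j → u (l j + k) = _ at hu
  refine ⟨u, ?_, ?_, ?_, ?_⟩
  · intro j hj k hk
    change u (l j + k) = _
    rw [hu j k hk, if_pos (by omega), ha j (by omega) k hk]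
  · intro j hj k hk hk'
    change dist (u (l j + k)) _ < _
    rw [hu j k (by omega), if_neg (by omega)]
    rw [Finset.sum_Ico_succ_top (by omega)]
    have h1 := hv1 (l j + k)
    have h2 := dist_triangle (v (l j + k)) (W (l j + k)) (f^[k] (x j))
    by_cases h : s j = t
    · have hnj := hn j
      rw [h] at hk hk' hnj ⊢
      have h3 : W (l j + k) = f^[k] (x j) := by
        rw [V4 j k (by omega) h hk (by omega), ha j (by omega) k (by omega)]
      rw [h3] at h1
      simpa using h1
    · rw [V1 j k (by omega) h] at h1 h2
      have := hb j (by omega) k hk hk'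
      linarith
  · intro j k hk
    change u (l j + (k + 1)) = f (u (l j + k))
    rw [hu j k (by omega), hu j (k + 1) hk]
    split_ifs with h
    · exact hc j k hk
    · exact hv2 (l j + k) (hB1 j k hk)
  · intro j h1 h2
    change u (l j + n j) = f (u (l j + (n j - 1)))
    rw [← ls, ← add_zero (l (j + 1)), hu (j + 1) 0 (hn0 _), hu j (n j - 1) (by have := hn0 j; omega),
      if_neg (by omega), if_neg (by omega), add_zero]
    have e1 : l j + (n j - 1) + 1 = l (j + 1) := by have := hn0 j; rw [ls]; omega
    have := hv2 (l j + (n j - 1)) (by rw [e1, hB2]; omega)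
    rw [e1] at this
    exact this

lemma multi_spec {X : Type*} [MetricSpace X] [CompactSpace X] {f : X → X}
    (hf : Continuous f) (hsh : Shadowing f) (hmix : TopMixing f) :
    ∃ M : ℕ → ℕ, Monotone M ∧ ∀ (n s : ℕ → ℕ) (x : ℕ → X), (∀ j, 2 * M (s j) + 1 ≤ n j) →
      ∃ z : X, ∀ j k, M (s j) ≤ k → k + M (s j) < n j →
        dist (f^[(∑ r ∈ Finset.range j, n r) + k] z) (f^[k] (x j)) ≤ (1 / 2 : ℝ) ^ s j := by
  let e : ℕ → ℝ := fun r => (1 / 2 : ℝ) ^ (r + 1)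
  have he : ∀ r, 0 < e r := fun r => by positivity
  choose δ hδ H using fun t => hsh (e t) (he t)
  choose M0 hM0 using fun t => uniform_chain hmix (hδ t)
  let M : ℕ → ℕ := fun t => ∑ r ∈ Finset.range (t + 1), (M0 r + 1)
  have hMmono : Monotone M := by
    intro a b hab
    exact Finset.sum_le_sum_of_subset (Finset.range_subset_range.2 (by omega))
  have hMge : ∀ t, M0 t + 1 ≤ M t := fun t =>
    Finset.single_le_sum (f := fun r => M0 r + 1) (fun _ _ => Nat.zero_le _)
      (Finset.mem_range.2 (Nat.lt_succ_self t))
  have hesum : ∀ a T, a ≤ T → ∑ r ∈ Finset.Ico a T, e r = (1/2 : ℝ) ^ a - (1/2 : ℝ) ^ T := by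
    intro a T h
    induction T, h using Nat.le_induction with
    | base => simp
    | succ T hT ih =>
      rw [Finset.sum_Ico_succ_top hT, ih]
      simp only [e, pow_succ]; ring
  have bounded : ∀ (T : ℕ) (n s : ℕ → ℕ) (x : ℕ → X), (∀ j, 2 * M (s j) + 1 ≤ n j) →
      (∀ j, s j < T) → ∃ z : X, ∀ j k, M (s j) ≤ k → k + M (s j) < n j →
        dist (f^[(∑ r ∈ Finset.range j, n r) + k] z) (f^[k] (x j)) ≤ (1 / 2 : ℝ) ^ s j := by
    intro T n s x hn hs
    have hn0 : ∀ j, 0 < n j := fun j => by have := hn j; omega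
    have hex : ∀ t, ∃ w, Stage f M e n s x t w := by
      intro t
      induction t with
      | zero =>
        obtain ⟨w, hw⟩ := glue hn0 (fun j k => f^[k] (x j))
        refine ⟨w, fun j _ k hk => hw j k hk, fun j hj => by omega, ?_, fun j hj => by omega⟩
        intro j k hk
        rw [hw j (k + 1) hk, hw j k (by omega), Function.iterate_succ_apply']
      | succ t ih =>
        obtain ⟨w, hw⟩ := ih
        exact stage_step (hδ t) (H t) (by have := hMge t; omega)
          (fun m hm => hM0 t m (by have := hMge t; omega)) hn hw
    obtain ⟨w, -, hb, hc, hd⟩ := hex T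
    have horb : ∀ i, w i = f^[i] (w 0) := by
      intro i
      induction i with
      | zero => rfl
      | succ i ih =>
        rw [Function.iterate_succ_apply', ← ih]
        obtain ⟨j, k, hk, rfl⟩ := block_exists hn0 i
        by_cases h : k + 1 < n j
        · exact hc j k h
        · have := hd j (hs j) (hs (j+1))
          rw [add_assoc, show k + 1 = n j by omega, show k = n j - 1 by omega]
          exact this
    refine ⟨w 0, fun j k h1 h2 => ?_⟩
    rw [← horb]
    refine (hb j (hs j) k h1 h2).le.trans ?_
    rw [hesum _ _ (hs j).le]
    have : (0:ℝ) < (1/2) ^ T := by positivity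
    linarith
  refine ⟨M, hMmono, fun n s x hn => ?_⟩
  choose z hz using fun S : ℕ => bounded (S + 1) n (fun j => min (s j) S) x
    (fun j => by
      have := hn j
      have : M (min (s j) S) ≤ M (s j) := hMmono (min_le_left _ _)
      omega)
    (fun j => by have := min_le_right (s j) S; omega)
  obtain ⟨a, φ, hφ, hlim⟩ := CompactSpace.tendsto_subseq z
  refine ⟨a, fun j k h1 h2 => ?_⟩
  have hcont : Continuous fun y : X => dist (f^[(∑ r ∈ Finset.range j, n r) + k] y) (f^[k] (x j)) :=
    (hf.iterate _).dist continuous_const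
  refine le_of_tendsto ((hcont.tendsto a).comp hlim) ?_
  filter_upwards [eventually_ge_atTop (s j)] with S hS
  have h3 : min (s j) (φ S) = s j := min_eq_left (hS.trans (hφ.id_le S))
  have := hz (φ S) j k
  simp only [h3] at this
  exact this h1 h2

lemma almostSpec_of_mixing {X : Type*} [MetricSpace X] [CompactSpace X] {f : X → X}
    (hf : Continuous f) (hsh : Shadowing f) (hmix : TopMixing f) : AlmostSpec f := by
  obtain ⟨M, -, hM⟩ := multi_spec hf hsh hmix
  have hL : ∀ ε : ℝ, ∃ L : ℕ, 0 < ε → (1 / 2 : ℝ) ^ L < ε := by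
    intro ε
    by_cases h : 0 < ε
    · obtain ⟨L, hL⟩ := exists_pow_lt_of_lt_one h (show (1/2 : ℝ) < 1 by norm_num)
      exact ⟨L, fun _ => hL⟩
    · exact ⟨0, fun h' => absurd h' h⟩
  choose L hL using hL
  refine ⟨fun _ ε => 2 * M (L (min ε 1)), 1, fun ε => 2 * M (L (min ε 1)) + 1,
    ⟨one_pos, fun _ _ _ _ => le_rfl, fun ε _ _ => tendsto_const_div_atTop_nhds_zero_nat _, ?_⟩, ?_⟩
  · intro n ε hε
    simp only [min_self, min_eq_right hε.le]
  · intro m hm ε x nseq hε hk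
    obtain ⟨z, hz⟩ := hM (fun j => if j < m then nseq (j + 1) else 2 * M 0 + 1)
      (fun j => if j < m then L (min (ε (j + 1)) 1) else 0) (fun j => x (j + 1)) (by
        intro j
        by_cases h : j < m
        · simp only [h, if_true]
          exact hk (j + 1) (by omega) (by omega)
        · simp only [h, if_false]; exact le_rfl)
    refine ⟨z, ?_⟩
    intro j hj1 hjm
    obtain ⟨i, rfl⟩ : ∃ i, j = i + 1 := ⟨j - 1, by omega⟩
    have him : i < m := by omega
    have hs : ∑ r ∈ Finset.range i, (if r < m then nseq (r + 1) else 2 * M 0 + 1) =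
        ∑ r ∈ Finset.Ico 1 (i + 1), nseq r := by
      rw [Finset.sum_Ico_eq_sum_range]
      apply Finset.sum_congr (by simp)
      intro r hr
      have : r < m := by have := Finset.mem_range.1 hr; omega
      rw [if_pos this, add_comm]
    have h1 := hz i
    simp only [him, if_true, hs] at h1
    have hk1 := hk (i + 1) hj1 hjm
    have hmin : 0 < min (ε (i + 1)) 1 := lt_min (hε _ hj1 hjm) one_pos
    have hlt := (hL _ hmin).trans_le (min_le_left _ _)
    simp only [mistakeBowenBall, mem_iUnion]
    refine ⟨Finset.Ico (M (L (min (ε (i + 1)) 1))) (nseq (i + 1) - M (L (min (ε (i + 1)) 1))),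
      ⟨?_, ?_⟩, ?_⟩
    · intro a ha
      rw [Finset.mem_Ico] at ha
      rw [Finset.mem_range]; omega
    · rw [Nat.card_Ico]; omega
    · intro a ha
      rw [Finset.mem_Ico] at ha
      have h2 := h1 a ha.1 (by omega)
      rw [← Function.iterate_add_apply, dist_comm, add_comm a]
      exact h2.trans_lt hlt

lemma short_trace {X : Type*} [MetricSpace X] [CompactSpace X] {f : X → X}
    (hf : Continuous f) (N : ℕ) : ∀ η : ℝ, 0 < η → ∃ γ : ℝ, 0 < γ ∧ ∀ w : ℕ → X,
      (∀ k < N, dist (f (w k)) (w (k + 1)) < γ) → ∀ k ≤ N, dist (f^[k] (w 0)) (w k) < η := by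
  induction N with
  | zero =>
    intro η hη
    refine ⟨1, one_pos, fun w _ k hk => ?_⟩
    obtain rfl : k = 0 := by omega
    simpa using hη
  | succ N ih =>
    intro η hη
    have huc := CompactSpace.uniformContinuous_of_continuous hf
    obtain ⟨θ, hθ, hfθ⟩ := Metric.uniformContinuous_iff.1 huc (η / 2) (half_pos hη)
    obtain ⟨γ, hγ, h⟩ := ih (min θ η) (lt_min hθ hη)
    refine ⟨min γ (η / 2), lt_min hγ (half_pos hη), fun w hw k hk => ?_⟩
    have h1 := h w (fun k hk => (hw k (by omega)).trans_le (min_le_left _ _))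
    rcases Nat.lt_or_ge k (N + 1) with hk' | hk'
    · exact (h1 k (by omega)).trans_le (min_le_right _ _)
    · obtain rfl : k = N + 1 := by omega
      have h2 := hfθ ((h1 N le_rfl).trans_le (min_le_left _ _))
      have h3 := (hw N (by omega)).trans_le (min_le_right _ _)
      rw [Function.iterate_succ_apply']
      have := dist_triangle (f (f^[N] (w 0))) (f (w N)) (w (N + 1))
      linarith

lemma track {X : Type*} [MetricSpace X] [CompactSpace X] {f : X → X}
    (hf : Continuous f) (hsh : Shadowing f) (hmix : TopMixing f) :
    ∃ K R : ℕ → ℝ, (∀ p, 0 ≤ K p) ∧ ∀ (w : ℕ → X) (p : ℕ → ℕ), Monotone p →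
      ∃ (y : X) (q : ℕ → ℕ), (∀ P, (∃ T, P ≤ p T) → ∀ᶠ i in atTop, P ≤ q i) ∧
        (∀ P, (∀ i, P ≤ p i) → ∀ i, P ≤ q i) ∧
        ∀ T : ℕ, ∑ i ∈ Finset.range T, dist (f^[i] y) (w i) ≤
          (∑ i ∈ Finset.range T, 3 * (1 / 2 : ℝ) ^ q i) +
          K (p T) * (∑ i ∈ Finset.range T, dist (f (w i)) (w (i + 1))) + R (p T) := by
  obtain ⟨D, hD, hdist⟩ := exists_diam X
  obtain ⟨M, hMmono, hM⟩ := multi_spec hf hsh hmix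
  have hN : ∀ s : ℕ, ∃ N : ℕ, 2 * M s + 1 ≤ N ∧ 2 * M s * D ≤ N * (1 / 2 : ℝ) ^ s := by
    intro s
    obtain ⟨N, hN⟩ := exists_nat_ge (2 * M s * D / (1 / 2 : ℝ) ^ s)
    refine ⟨N + (2 * M s + 1), by omega, ?_⟩
    rw [div_le_iff₀ (by positivity)] at hN
    push_cast
    have : (0:ℝ) ≤ (2 * M s + 1) * (1 / 2 : ℝ) ^ s := by positivity
    nlinarith
  choose N hN1 hN2 using hN
  choose γ hγ hg using fun s => short_trace hf (N s) ((1 / 2 : ℝ) ^ s) (by positivity)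
  let k0 : ℕ → ℝ := fun s => D * N s / γ s
  have hk0 : ∀ s, 0 ≤ k0 s := fun s => by have := hγ s; positivity
  let K : ℕ → ℝ := fun s => ∑ r ∈ Finset.range (s + 1), k0 r
  let R : ℕ → ℝ := fun s => ∑ r ∈ Finset.range (s + 1), D * N r
  have hKge : ∀ r s, r ≤ s → k0 r ≤ K s := fun r s h =>
    Finset.single_le_sum (fun i _ => hk0 i) (Finset.mem_range.2 (by omega))
  have hRge : ∀ r s, r ≤ s → D * N r ≤ R s := fun r s h =>
    Finset.single_le_sum (f := fun r => D * (N r : ℝ)) (fun i _ => by positivity)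
      (Finset.mem_range.2 (by omega))
  refine ⟨K, R, fun p => Finset.sum_nonneg fun i _ => hk0 i, fun w p hp => ?_⟩
  -- the blocks
  let l : ℕ → ℕ := fun j => Nat.rec 0 (fun _ a => a + N (p a)) j
  have l0 : l 0 = 0 := rfl
  have ls : ∀ j, l (j + 1) = l j + N (p (l j)) := fun j => rfl
  let n : ℕ → ℕ := fun j => N (p (l j))
  have hl : ∀ j, ∑ r ∈ Finset.range j, n r = l j := by
    intro j
    induction j with
    | zero => rfl
    | succ j ih => rw [Finset.sum_range_succ, ih, ls]
  have hn0 : ∀ j, 0 < n j := fun j => by have := hN1 (p (l j)); show 0 < N _; omega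
  have llt : ∀ j j', j < j' → l j + n j ≤ l j' := by
    intro j j' h
    have := block_mono n h
    rwa [hl, hl] at this
  obtain ⟨y, hy⟩ := hM n (fun j => p (l j)) (fun j => w (l j)) (fun j => hN1 _)
  obtain ⟨q, hq⟩ := glue hn0 (fun j _ => p (l j))
  simp only [hl] at hy hq
  have hblk : ∀ i, ∃ j k, k < n j ∧ i = l j + k := by
    intro i
    have := block_exists hn0 i
    simpa only [hl] using this
  refine ⟨y, q, ?_, ?_, ?_⟩
  · rintro P ⟨T, hT⟩
    obtain ⟨j0, k0, hk0, e0⟩ := hblk T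
    filter_upwards [eventually_ge_atTop (l (j0 + 1))] with i hi
    obtain ⟨j, k, hk, rfl⟩ := hblk i
    rw [hq j k hk]
    have hj : j0 < j := by
      by_contra hcon
      have h1 : l j + n j ≤ l (j0 + 1) := llt j (j0 + 1) (by omega)
      omega
    have := llt j0 j hj
    exact hT.trans (hp (by omega))
  · intro P hP i
    obtain ⟨j, k, hk, rfl⟩ := hblk i
    rw [hq j k hk]
    exact hP _
  · set a : ℕ → ℝ := fun i => dist (f (w i)) (w (i + 1)) with ha
    have a0 : ∀ i, 0 ≤ a i := fun i => dist_nonneg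
    set e : ℕ → ℝ := fun i => dist (f^[i] y) (w i) with he
    have e0 : ∀ i, 0 ≤ e i := fun i => dist_nonneg
    -- one block
    have one : ∀ j, ∑ k ∈ Finset.range (n j), e (l j + k) ≤
        (∑ k ∈ Finset.range (n j), 3 * (1 / 2 : ℝ) ^ q (l j + k)) +
        k0 (p (l j)) * ∑ k ∈ Finset.range (n j), a (l j + k) := by
      intro j
      have hq' : ∑ k ∈ Finset.range (n j), 3 * (1 / 2 : ℝ) ^ q (l j + k) =
          n j * (3 * (1 / 2 : ℝ) ^ p (l j)) := by
        rw [← nsmul_eq_mul, ← Finset.card_range (n j), ← Finset.sum_const, Finset.card_range]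
        apply Finset.sum_congr rfl
        intro k hk
        rw [hq j k (Finset.mem_range.1 hk)]
      rw [hq']
      generalize hs : p (l j) = s at *
      have hnj : n j = N s := by show N (p (l j)) = N s; rw [hs]
      rw [hnj]
      by_cases hbad : ∃ k < N s, γ s ≤ a (l j + k)
      · obtain ⟨k, hk, hk'⟩ := hbad
        have h1 : γ s ≤ ∑ k ∈ Finset.range (N s), a (l j + k) :=
          hk'.trans (Finset.single_le_sum (f := fun k => a (l j + k)) (fun i _ => a0 _)
            (Finset.mem_range.2 hk))
        have h2 : ∑ k ∈ Finset.range (N s), e (l j + k) ≤ D * N s := by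
          calc _ ≤ ∑ k ∈ Finset.range (N s), D := Finset.sum_le_sum fun _ _ => hdist _ _
            _ = _ := by simp [mul_comm]
        have h3 : D * N s ≤ k0 s * ∑ k ∈ Finset.range (N s), a (l j + k) := by
          calc D * N s = k0 s * γ s := by
                simp only [k0]; rw [div_mul_cancel₀ _ (hγ s).ne']
            _ ≤ _ := mul_le_mul_of_nonneg_left h1 (hk0 s)
        have h4 : 0 ≤ (N s : ℝ) * (3 * (1 / 2 : ℝ) ^ s) := by positivity
        linarith
      · push Not at hbad
        have h1 : ∀ k ∈ Finset.range (N s), e (l j + k) ≤ 2 * (1 / 2 : ℝ) ^ s +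
            ((if k < M s then D else 0) + if N s - M s ≤ k then D else 0) := by
          intro k hk
          rw [Finset.mem_range] at hk
          have hpos : (0:ℝ) < (1/2) ^ s := by positivity
          by_cases hk1 : k < M s
          · have := hdist (f^[l j + k] y) (w (l j + k))
            rw [if_pos hk1]
            have : (0:ℝ) ≤ if N s - M s ≤ k then D else 0 := by split_ifs <;> linarith
            simp only [he]
            linarith
          · by_cases hk2 : N s - M s ≤ k
            · have := hdist (f^[l j + k] y) (w (l j + k))
              rw [if_pos hk2, if_neg hk1]
              simp only [he]
              linarith
            · rw [if_neg hk1, if_neg hk2]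
              have h2 := hy j k (by rw [hs]; omega) (by rw [hs, hnj]; omega)
              rw [hs] at h2
              have h3 := hg s (fun k => w (l j + k)) (fun k hk => hbad k hk) k hk.le
              have h4 := dist_triangle (f^[l j + k] y) (f^[k] (w (l j))) (w (l j + k))
              simp only [add_zero] at h3
              simp only [he]
              linarith
        refine (Finset.sum_le_sum h1).trans ?_
        rw [Finset.sum_add_distrib, Finset.sum_add_distrib, Finset.sum_const, Finset.card_range,
          nsmul_eq_mul, ← Finset.sum_filter, ← Finset.sum_filter, Finset.sum_const,
          Finset.sum_const, nsmul_eq_mul, nsmul_eq_mul]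
        have c1 : ((Finset.range (N s)).filter (fun k => k < M s)).card ≤ M s := by
          calc _ ≤ (Finset.range (M s)).card := Finset.card_le_card (by
                intro k hk
                rw [Finset.mem_filter] at hk
                exact Finset.mem_range.2 hk.2)
            _ = M s := by simp
        have c2 : ((Finset.range (N s)).filter (fun k => N s - M s ≤ k)).card ≤ M s := by
          calc _ ≤ (Finset.Ico (N s - M s) (N s)).card := Finset.card_le_card (by
                intro k hk
                rw [Finset.mem_filter, Finset.mem_range] at hk
                exact Finset.mem_Ico.2 ⟨hk.2, hk.1⟩)
            _ ≤ M s := by rw [Nat.card_Ico]; omega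
        have c1' : (((Finset.range (N s)).filter (fun k => k < M s)).card : ℝ) ≤ M s := by
          exact_mod_cast c1
        have c2' : (((Finset.range (N s)).filter (fun k => N s - M s ≤ k)).card : ℝ) ≤ M s := by
          exact_mod_cast c2
        have c3 := mul_le_mul_of_nonneg_right c1' hD.le
        have c4 := mul_le_mul_of_nonneg_right c2' hD.le
        have c5 := hN2 s
        have c6 : 0 ≤ k0 s * ∑ k ∈ Finset.range (N s), a (l j + k) :=
          mul_nonneg (hk0 s) (Finset.sum_nonneg fun _ _ => a0 _)
        linarith
    intro T
    -- full blocks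
    have full : ∀ J, (J = 0 ∨ l J ≤ T) → ∑ i ∈ Finset.range (l J), e i ≤
        (∑ i ∈ Finset.range (l J), 3 * (1 / 2 : ℝ) ^ q i) +
        K (p T) * ∑ i ∈ Finset.range (l J), a i := by
      intro J
      induction J with
      | zero => intro _; simp [l0]
      | succ J ih =>
        intro h
        have hT : l (J + 1) ≤ T := by omega
        have hJ : l J ≤ T := by rw [ls] at hT; omega
        have h1 := ih (Or.inr hJ)
        have h2 := one J
        have h3 : k0 (p (l J)) * ∑ k ∈ Finset.range (n J), a (l J + k) ≤
            K (p T) * ∑ k ∈ Finset.range (n J), a (l J + k) :=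
          mul_le_mul_of_nonneg_right (hKge _ _ (hp hJ)) (Finset.sum_nonneg fun _ _ => a0 _)
        have e1 : l (J + 1) = l J + n J := rfl
        rw [e1, Finset.sum_range_add, Finset.sum_range_add, Finset.sum_range_add, mul_add]
        linarith
    obtain ⟨J, k, hk, rfl⟩ := hblk T
    have h1 := full J (Or.inr (by omega))
    rw [Finset.sum_range_add, Finset.sum_range_add, Finset.sum_range_add, mul_add]
    have h2 : ∑ i ∈ Finset.range k, e (l J + i) ≤ R (p (l J + k)) := by
      calc ∑ i ∈ Finset.range k, e (l J + i) ≤ ∑ i ∈ Finset.range k, D :=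
            Finset.sum_le_sum fun _ _ => hdist _ _
        _ = D * k := by simp [mul_comm]
        _ ≤ D * N (p (l J)) := by
            have : (k : ℝ) ≤ N (p (l J)) := by exact_mod_cast hk.le
            exact mul_le_mul_of_nonneg_left this hD.le
        _ ≤ _ := hRge _ _ (hp (by omega))
    have h3 : 0 ≤ ∑ i ∈ Finset.range k, 3 * (1 / 2 : ℝ) ^ q (l J + i) :=
      Finset.sum_nonneg fun _ _ => by positivity
    have h4 : 0 ≤ K (p (l J + k)) * ∑ i ∈ Finset.range k, a (l J + i) :=
      mul_nonneg (Finset.sum_nonneg fun i _ => hk0 i) (Finset.sum_nonneg fun _ _ => a0 _)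
    linarith

open Classical in
lemma diag (b : ℕ → ℕ → ℝ) (hb0 : ∀ p T, 0 ≤ b p T) (hb : ∀ p, Tendsto (b p) atTop (nhds 0)) :
    ∃ p : ℕ → ℕ, Monotone p ∧ Tendsto p atTop atTop ∧
      Tendsto (fun T => b (p T) T) atTop (nhds 0) := by
  let Q : ℕ → ℕ → Prop := fun T p => ∀ T' ≥ T, b p T' ≤ 1 / ((p : ℝ) + 1)
  have hQ : ∀ p, ∀ᶠ T in atTop, Q T p := by
    intro p
    obtain ⟨T0, h⟩ := eventually_atTop.1
      ((hb p).eventually (ge_mem_nhds (show (0:ℝ) < 1 / ((p : ℝ) + 1) by positivity)))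
    filter_upwards [eventually_ge_atTop T0] with T hT T' hT'
    exact h T' (hT.trans hT')
  let p : ℕ → ℕ := fun T => Nat.findGreatest (Q T) T
  have hp : Tendsto p atTop atTop := by
    rw [Filter.tendsto_atTop]
    intro P
    filter_upwards [hQ P, eventually_ge_atTop P] with T h1 h2
    exact Nat.le_findGreatest h2 h1
  refine ⟨p, ?_, hp, ?_⟩
  · intro T T' h
    exact Nat.findGreatest_mono (fun P hP T'' hT'' => hP T'' (h.trans hT'')) h
  · have h1 : Tendsto (fun T => 1 / ((p T : ℝ) + 1)) atTop (nhds 0) :=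
      tendsto_one_div_add_atTop_nhds_zero_nat.comp hp
    refine squeeze_zero' (Eventually.of_forall fun T => hb0 _ _) ?_ h1
    filter_upwards [hQ 0] with T h
    exact (Nat.findGreatest_spec (P := Q T) (Nat.zero_le T) h) T le_rfl

lemma aasp_of_mixing {X : Type*} [MetricSpace X] [CompactSpace X] {f : X → X}
    (hf : Continuous f) (hsh : Shadowing f) (hmix : TopMixing f) : AsympAvgShadowing f := by
  obtain ⟨K, R, hK, H⟩ := track hf hsh hmix
  intro w hw
  obtain ⟨p, hp, hpt, hlim⟩ := diag
    (fun p T => K p * ((∑ i ∈ Finset.range T, dist (f (w i)) (w (i + 1))) / T) + |R p| / T)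
    (fun p T => by have := hK p; positivity)
    (fun p => by
      have h1 := hw.const_mul (K p)
      have h2 := tendsto_const_div_atTop_nhds_zero_nat |R p|
      have := h1.add h2
      simpa using this)
  obtain ⟨y, q, hq, -, hy⟩ := H w p hp
  refine ⟨y, ?_⟩
  have hqt : Tendsto q atTop atTop := by
    rw [Filter.tendsto_atTop]
    intro P
    exact hq P ((hpt.eventually (eventually_ge_atTop P)).exists)
  have h3 : Tendsto (fun i => 3 * (1 / 2 : ℝ) ^ q i) atTop (nhds 0) := by
    have := ((tendsto_pow_atTop_nhds_zero_of_lt_one (show (0:ℝ) ≤ 1/2 by norm_num)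
      (by norm_num)).comp hqt).const_mul 3
    simpa using this
  have h4 := h3.cesaro.add hlim
  rw [add_zero] at h4
  refine squeeze_zero (fun n => by positivity) (fun T => ?_) h4
  rcases Nat.eq_zero_or_pos T with rfl | hT
  · simp
  have hTpos : (0:ℝ) < T := by exact_mod_cast hT
  have h5 := hy T
  have h6 := le_abs_self (R (p T))
  rw [div_le_iff₀ hTpos]
  refine h5.trans (le_trans (add_le_add_right h6 _) (le_of_eq ?_))
  field_simp
  ring

lemma asp_of_mixing {X : Type*} [MetricSpace X] [CompactSpace X] {f : X → X}
    (hf : Continuous f) (hsh : Shadowing f) (hmix : TopMixing f) : AvgShadowing f := by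
  obtain ⟨K, R, hK, H⟩ := track hf hsh hmix
  intro ε hε
  obtain ⟨P, hP⟩ := exists_pow_lt_of_lt_one (show 0 < ε / 12 by positivity)
    (show (1/2 : ℝ) < 1 by norm_num)
  have hKP := hK P
  refine ⟨ε / (4 * (K P + 1)), by positivity, fun w ⟨N, hN, hw⟩ => ?_⟩
  obtain ⟨y, q, -, hq, hy⟩ := H w (fun _ => P) monotone_const
  refine ⟨y, ?_⟩
  have hq' := hq P (fun _ => le_rfl)
  obtain ⟨N', hN'⟩ := exists_nat_gt (R P / (ε / 4))
  rw [div_lt_iff₀ (by positivity)] at hN'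
  have hev : ∀ᶠ T : ℕ in atTop, (∑ i ∈ Finset.range T, dist (f^[i] y) (w i)) / T ≤ 3 * ε / 4 := by
    filter_upwards [eventually_ge_atTop N, eventually_ge_atTop N'] with T hT hT'
    have hTpos : (0:ℝ) < T := by exact_mod_cast (by omega : 0 < T)
    rw [div_le_iff₀ hTpos]
    refine (hy T).trans ?_
    have h1 : ∑ i ∈ Finset.range T, 3 * (1 / 2 : ℝ) ^ q i ≤ ∑ i ∈ Finset.range T, ε / 4 := by
      apply Finset.sum_le_sum
      intro i _
      have : (1 / 2 : ℝ) ^ q i ≤ (1 / 2 : ℝ) ^ P :=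
        pow_le_pow_of_le_one (by norm_num) (by norm_num) (hq' i)
      linarith
    rw [Finset.sum_const, Finset.card_range, nsmul_eq_mul] at h1
    have h2 := hw T hT 0
    simp only [add_zero] at h2
    rw [div_lt_iff₀ hTpos] at h2
    have h3 : K P * ∑ i ∈ Finset.range T, dist (f (w i)) (w (i + 1)) ≤ ε / 4 * T := by
      calc _ ≤ K P * (ε / (4 * (K P + 1)) * T) := mul_le_mul_of_nonneg_left h2.le hKP
        _ ≤ (K P + 1) * (ε / (4 * (K P + 1)) * T) := by gcongr; linarith
        _ = _ := by field_simp
    have h4 : (N' : ℝ) ≤ T := by exact_mod_cast hT'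
    have h5 : R P ≤ ε / 4 * T := by nlinarith
    linarith
  have h6 : limsup (fun n : ℕ => (∑ i ∈ Finset.range n, dist (f^[i] y) (w i)) / n) atTop ≤ 3 * ε / 4 := by
    refine limsup_le_of_le ?_ hev
    exact isCoboundedUnder_le_of_le atTop (x := 0) fun n => by positivity
  show limsup _ _ < ε
  linarith

end ShTfae


/-- Equivalences under shadowing. -/
theorem shadowing_tfae
    {X : Type*} [MetricSpace X] [CompactSpace X]
    (f : X → X) (hf : Continuous f) (hsh : Shadowing f) :
    List.TFAE
      [TotallyTransitive f,
       WeaklyMixing f,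
       TopMixing f,
       Function.Surjective f ∧ AlmostSpec f,
       Function.Surjective f ∧ AsympAvgShadowing f,
       Function.Surjective f ∧ AvgShadowing f] := by
  have cm : ChainMixing f → TopMixing f := ShTfae.topMixing_of_chainMixing hsh
  tfae_have 1 → 3 := fun h => cm (ShTfae.chainMixing_of_total h)
  tfae_have 2 → 3 := fun h => cm (ShTfae.chainMixing_of_weak h)
  tfae_have 4 → 3 := fun h => cm (ShTfae.chainMixing_of_almostSpec h.1 h.2)
  tfae_have 5 → 3 := fun h => cm (ShTfae.chainMixing_of_aasp h.1 h.2)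
  tfae_have 6 → 3 := fun h => cm (ShTfae.chainMixing_of_asp h.1 h.2)
  tfae_have 3 → 1 := ShTfae.total_of_mixing
  tfae_have 3 → 2 := ShTfae.weak_of_mixing
  tfae_have 3 → 4 := fun h => ⟨ShTfae.surj_of_mixing hf h, ShTfae.almostSpec_of_mixing hf hsh h⟩
  tfae_have 3 → 5 := fun h => ⟨ShTfae.surj_of_mixing hf h, ShTfae.aasp_of_mixing hf hsh h⟩
  tfae_have 3 → 6 := fun h => ⟨ShTfae.surj_of_mixing hf h, ShTfae.asp_of_mixing hf hsh h⟩
  tfae_finish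
end

section
/- Let (X,f) be a dynamical system with X a compact metric space and f : X → X continuous, and let A ⊆ X be a closed set with f(A) ⊆ A which contains the measure center of f. If the restriction f|_A : A → A has the almost specification property on A, then f has the almost specification property on X. -/
open Filter Metric Set MeasureTheory Topology

/-- Number of times `i < n` with `f^i x` outside the `δ`-thickening of `A`. -/
noncomputable def awayCount {X : Type*} [MetricSpace X] (f : X → X) (A : Set X) (δ : ℝ)
    (n : ℕ) (x : X) : ℕ := by
  classical
  exact Nat.count (fun i => f^[i] x ∉ thickening δ A) n

lemma measure_compl_eq_zero {X : Type*} [MetricSpace X] [CompactSpace X]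
    [MeasurableSpace X] [BorelSpace X] (f : X → X) (A : Set X)
    (hmc : measureCenter f ⊆ A) (μ : Measure X) (hμ : InvariantProb f μ) : μ Aᶜ = 0 := by
  refine measure_null_of_locally_null _ (fun x hx => ?_)
  have hx' : x ∉ measureCenter f := fun h => hx (hmc h)
  simp only [measureCenter, Set.mem_compl_iff, not_not, Set.mem_iUnion] at hx'
  obtain ⟨U, ⟨hU, hUn⟩, hxU⟩ := hx'
  exact ⟨U, mem_nhdsWithin_of_mem_nhds (hU.mem_nhds hxU), hUn μ hμ⟩

/-- The empirical measure. -/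
noncomputable def empMeas {X : Type*} [MeasurableSpace X] (f : X → X) (n : ℕ) (x : X) :
    Measure X :=
  ((n + 1 : ℕ) : ENNReal)⁻¹ • ∑ i ∈ Finset.range (n + 1), Measure.dirac (f^[i] x)

lemma empMeas_prob {X : Type*} [MeasurableSpace X] (f : X → X) (n : ℕ) (x : X) :
    IsProbabilityMeasure (empMeas f n x) := by
  constructor
  simp only [empMeas, Measure.smul_apply, Measure.finsetSum_apply, measure_univ,
    Finset.sum_const, Finset.card_range, smul_eq_mul, nsmul_eq_mul, mul_one]
  exact ENNReal.inv_mul_cancel (by simp) (by simp)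

lemma integral_empMeas {X : Type*} [MetricSpace X] [CompactSpace X]
    [MeasurableSpace X] [BorelSpace X] (f : X → X) (n : ℕ) (x : X) (φ : X → ℝ)
    (hφ : Continuous φ) :
    ∫ y, φ y ∂(empMeas f n x) = (∑ i ∈ Finset.range (n + 1), φ (f^[i] x)) / ((n + 1 : ℕ) : ℝ) := by
  rw [empMeas, integral_smul_measure, integral_finsetSum_measure]
  · simp only [integral_dirac]
    rw [ENNReal.toReal_inv, ENNReal.toReal_natCast, smul_eq_mul, div_eq_inv_mul]
  · intro i _
    exact hφ.integrable_of_hasCompactSupport (HasCompactSupport.of_compactSpace φ)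

lemma awayCount_small {X : Type*} [MetricSpace X] [CompactSpace X]
    [MeasurableSpace X] [BorelSpace X] (f : X → X) (hf : Continuous f) (A : Set X)
    (hA : IsClosed A) (hmc : measureCenter f ⊆ A) (δ : ℝ) (hδ : 0 < δ) (η : ℝ) (hη : 0 < η) :
    ∃ N : ℕ, ∀ n, N ≤ n → ∀ x : X, (awayCount f A δ n x : ℝ) ≤ η * n := by
  classical
  by_contra hcon
  push Not at hcon
  choose n hn x hx using hcon
  -- all lengths with positive index are positive
  have hn1 : ∀ k, 1 ≤ n (k + 1) := fun k => le_trans (by omega) (hn (k + 1))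
  let ν : ℕ → ProbabilityMeasure X := fun k =>
    ⟨empMeas f (n (k + 1) - 1) (x (k + 1)), empMeas_prob _ _ _⟩
  have hνi : ∀ k (φ : X → ℝ), Continuous φ → ∫ y, φ y ∂(ν k : Measure X) =
      (∑ i ∈ Finset.range (n (k + 1)), φ (f^[i] (x (k + 1)))) / (n (k + 1) : ℝ) := by
    intro k φ hφ
    have := integral_empMeas f (n (k + 1) - 1) (x (k + 1)) φ hφ
    rwa [Nat.sub_add_cancel (hn1 k)] at this
  let F : Ultrafilter (ProbabilityMeasure X) := (Ultrafilter.of atTop : Ultrafilter ℕ).map ν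
  obtain ⟨μ, -, hμ⟩ := isCompact_iff_ultrafilter_le_nhds.1
    (isCompact_univ : IsCompact (Set.univ : Set (ProbabilityMeasure X))) F (by simp)
  let G : Filter ℕ := ((Ultrafilter.of atTop : Ultrafilter ℕ) : Filter ℕ)
  have hG : G ≤ atTop := Ultrafilter.of_le _
  have hT : Tendsto ν G (𝓝 μ) := hμ
  have hT' : ∀ φ : BoundedContinuousFunction X ℝ, Tendsto (fun k => ∫ y, φ y ∂(ν k : Measure X)) G
      (𝓝 (∫ y, φ y ∂(μ : Measure X))) :=
    fun φ => ProbabilityMeasure.tendsto_iff_forall_integral_tendsto.1 hT φ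
  have hnT : Tendsto (fun k => (n (k + 1) : ℝ)) atTop atTop := by
    refine tendsto_natCast_atTop_atTop.comp (tendsto_atTop_mono (fun k => ?_) tendsto_id)
    exact le_trans (Nat.le_succ k) (hn (k + 1))
  -- invariance
  have hinv : (μ : Measure X).map f = (μ : Measure X) := by
    have : IsProbabilityMeasure ((μ : Measure X).map f) :=
      Measure.isProbabilityMeasure_map hf.aemeasurable
    refine ext_of_forall_integral_eq_of_IsFiniteMeasure (fun φ => ?_)
    rw [integral_map hf.aemeasurable φ.continuous.aestronglyMeasurable]
    have h1 := hT' φ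
    have h2 := hT' (φ.compContinuous ⟨f, hf⟩)
    have h3 : Tendsto (fun k => ∫ y, φ (f y) ∂(ν k : Measure X) - ∫ y, φ y ∂(ν k : Measure X))
        G (𝓝 0) := by
      refine Tendsto.mono_left ?_ hG
      have hb : Tendsto (fun k => (2 * ‖φ‖) / (n (k + 1) : ℝ)) atTop (𝓝 0) :=
        hnT.const_div_atTop _
      refine squeeze_zero_norm (fun k => ?_) hb
      rw [hνi k (fun y => φ (f y)) (φ.continuous.comp hf), hνi k _ φ.continuous, ← sub_div, norm_div,
        ← Finset.sum_sub_distrib]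
      have : ∑ i ∈ Finset.range (n (k + 1)), (φ (f (f^[i] (x (k + 1)))) - φ (f^[i] (x (k + 1))))
          = φ (f^[n (k + 1)] (x (k + 1))) - φ (x (k + 1)) := by
        have := Finset.sum_range_sub (fun i => φ (f^[i] (x (k + 1)))) (n (k + 1))
        simpa [Function.iterate_succ_apply'] using this
      rw [this, Real.norm_natCast]
      gcongr
      calc _ ≤ ‖φ (f^[n (k + 1)] (x (k + 1)))‖ + ‖φ (x (k + 1))‖ := norm_sub_le _ _
        _ ≤ ‖φ‖ + ‖φ‖ := add_le_add (φ.norm_coe_le_norm _) (φ.norm_coe_le_norm _)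
        _ = _ := by ring
    have h4 := tendsto_nhds_unique (h2.sub h1) h3
    exact sub_eq_zero.1 h4
  have hip : InvariantProb f (μ : Measure X) := by
    refine ⟨inferInstance, fun B hB => ?_⟩
    rw [← Measure.map_apply hf.measurable hB, hinv]
  have hnull := measure_compl_eq_zero f A hmc _ hip
  let ψ : X → ℝ := fun y => ((thickenedIndicator hδ A y : NNReal) : ℝ)
  have hψc : Continuous ψ := NNReal.continuous_coe.comp (thickenedIndicator hδ A).continuous
  have hψ1 : ∀ y ∈ A, ψ y = 1 := fun y hy => by
    change ((thickenedIndicator hδ A y : NNReal) : ℝ) = 1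
    rw [thickenedIndicator_one hδ A hy]; rfl
  have hψ0 : ∀ y, y ∉ thickening δ A → ψ y = 0 := fun y hy => by
    change ((thickenedIndicator hδ A y : NNReal) : ℝ) = 0
    rw [thickenedIndicator_zero hδ A hy]; rfl
  have hψle : ∀ y, ψ y ≤ 1 := fun y => NNReal.coe_le_one.2 (thickenedIndicator_le_one hδ A y)
  have hψint : ∫ y, ψ y ∂(μ : Measure X) = 1 := by
    have : ψ =ᵐ[(μ : Measure X)] fun _ => 1 := by
      have h0 : ∀ᵐ y ∂(μ : Measure X), y ∈ A := by
        rw [ae_iff]; exact hnull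
      filter_upwards [h0] with y hy
      exact hψ1 y hy
    rw [integral_congr_ae this]; simp
  have hlim := hT' (BoundedContinuousFunction.mkOfCompact ⟨ψ, hψc⟩)
  have hle : ∀ k, ∫ y, ψ y ∂(ν k : Measure X) ≤ 1 - η := by
    intro k
    have hpos : (0 : ℝ) < n (k + 1) := by exact_mod_cast hn1 k
    rw [hνi k _ hψc, div_le_iff₀ hpos]
    have hxk := hx (k + 1)
    have : ∑ i ∈ Finset.range (n (k + 1)), ψ (f^[i] (x (k + 1))) ≤
        ∑ i ∈ Finset.range (n (k + 1)),
          (1 - if f^[i] (x (k + 1)) ∉ thickening δ A then (1 : ℝ) else 0) := by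
      refine Finset.sum_le_sum (fun i _ => ?_)
      by_cases hh : f^[i] (x (k + 1)) ∈ thickening δ A
      · simpa [hh] using hψle _
      · simpa [hh] using (hψ0 _ hh).le
    rw [Finset.sum_sub_distrib, ← Finset.natCast_card_filter] at this
    have e : (((Finset.range (n (k + 1))).filter
        (fun i => f^[i] (x (k + 1)) ∉ thickening δ A)).card : ℝ)
        = awayCount f A δ (n (k + 1)) (x (k + 1)) := by
      unfold awayCount; rw [Nat.count_eq_card_filter_range]
    rw [e] at this
    simp only [Finset.sum_const, Finset.card_range, nsmul_eq_mul, mul_one] at this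
    linarith
  have := le_of_tendsto hlim (Eventually.of_forall hle)
  have h1 : ∫ y, ψ y ∂(μ : Measure X) ≤ 1 - η := this
  linarith

/-- Number of times `j < n` at which `z` does not `ε`-trace `x`. -/
noncomputable def missCount {X : Type*} [MetricSpace X] (f : X → X) (n : ℕ) (x z : X)
    (ε : ℝ) : ℕ := by
  classical
  exact Nat.count (fun j => ¬ dist (f^[j] x) (f^[j] z) < ε) n

section Comb

variable {X : Type*} [MetricSpace X]

lemma count_le_of_imp {p q : ℕ → Prop} [DecidablePred p] [DecidablePred q] (n : ℕ)
    (h : ∀ k < n, p k → q k) : Nat.count p n ≤ Nat.count q n := by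
  rw [Nat.count_eq_card_filter_range, Nat.count_eq_card_filter_range]
  refine Finset.card_le_card (fun k hk => ?_)
  simp only [Finset.mem_filter, Finset.mem_range] at hk ⊢
  exact ⟨hk.1, h k hk.1 hk.2⟩

lemma mem_ball_iff (f : X → X) (g : ℕ → ℝ → ℕ) (n : ℕ) (x z : X) (ε : ℝ) :
    z ∈ mistakeBowenBall f g n x ε ↔ missCount f n x z ε ≤ g n ε := by
  classical
  have hsplit := Finset.card_filter_add_card_filter_not (s := Finset.range n)
    (fun j => dist (f^[j] x) (f^[j] z) < ε)
  have hm : missCount f n x z ε =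
      ((Finset.range n).filter (fun j => ¬ dist (f^[j] x) (f^[j] z) < ε)).card := by
    unfold missCount; rw [Nat.count_eq_card_filter_range]
  rw [Finset.card_range] at hsplit
  rw [hm]
  simp only [mistakeBowenBall, Set.mem_iUnion, Set.mem_ofPred_eq, bowenBallAlong]
  constructor
  · rintro ⟨Λ, ⟨hΛ, hc⟩, hz⟩
    have : Λ.card ≤ ((Finset.range n).filter (fun j => dist (f^[j] x) (f^[j] z) < ε)).card :=
      Finset.card_le_card (fun j hj => Finset.mem_filter.2 ⟨hΛ hj, hz j hj⟩)
    omega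
  · intro h
    refine ⟨(Finset.range n).filter (fun j => dist (f^[j] x) (f^[j] z) < ε),
      ⟨Finset.filter_subset _ _, by omega⟩, fun j hj => (Finset.mem_filter.1 hj).2⟩

lemma missCount_le (f : X → X) (n : ℕ) (x z : X) (ε : ℝ) : missCount f n x z ε ≤ n := by
  unfold missCount; exact Nat.count_le _

lemma missCount_anti (f : X → X) (n : ℕ) (x z : X) {ε ε' : ℝ} (h : ε' ≤ ε) :
    missCount f n x z ε ≤ missCount f n x z ε' := by
  unfold missCount
  exact count_le_of_imp n (fun k _ hk hk' => hk (lt_of_lt_of_le hk' h))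

lemma missCount_add (f : X → X) (a b : ℕ) (x z : X) (ε : ℝ) :
    missCount f (a + b) x z ε = missCount f a x z ε + missCount f b (f^[a] x) (f^[a] z) ε := by
  unfold missCount
  rw [Nat.count_add]
  simp only [← Function.iterate_add_apply, add_comm a]

lemma awayCount_add (f : X → X) (A : Set X) (δ : ℝ) (a b : ℕ) (x : X) :
    awayCount f A δ (a + b) x = awayCount f A δ a x + awayCount f A δ b (f^[a] x) := by
  unfold awayCount
  rw [Nat.count_add]
  have : ∀ k, f^[a + k] x = f^[k] (f^[a] x) := fun k => by
    rw [add_comm, Function.iterate_add_apply]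
  congr 1
  classical
  refine le_antisymm (count_le_of_imp _ (fun k _ hk => ?_)) (count_le_of_imp _ (fun k _ hk => ?_))
  · rw [← this k]; exact hk
  · rw [this k]; exact hk

lemma awayCount_pos (f : X → X) (A : Set X) (δ : ℝ) (n : ℕ) (hn : 1 ≤ n) (x : X)
    (hx : x ∉ thickening δ A) : 1 ≤ awayCount f A δ n x := by
  classical
  obtain ⟨k, rfl⟩ := Nat.exists_eq_add_of_le hn
  rw [awayCount_add]
  refine le_trans ?_ (Nat.le_add_right _ _)
  unfold awayCount
  simp [Nat.count_succ, hx]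

/-- `z` traces the list of blocks `(point, length, precision)`. -/
def Traces (f : X → X) (g : ℕ → ℝ → ℕ) : X → List (X × ℕ × ℝ) → Prop
  | _, [] => True
  | z, b :: L => missCount f b.2.1 b.1 z b.2.2 ≤ g b.2.1 b.2.2 ∧ Traces f g (f^[b.2.1] z) L

/-- total length of a list of blocks -/
def tlen (L : List (X × ℕ × ℝ)) : ℕ := (L.map (fun b => b.2.1)).sum

lemma tlen_append (L K : List (X × ℕ × ℝ)) : tlen (L ++ K) = tlen L + tlen K := by
  simp [tlen]

lemma traces_append (f : X → X) (g : ℕ → ℝ → ℕ) (L K : List (X × ℕ × ℝ)) (z : X) :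
    Traces f g z (L ++ K) ↔ Traces f g z L ∧ Traces f g (f^[tlen L] z) K := by
  induction L generalizing z with
  | nil => simp [Traces, tlen]
  | cons b L ih =>
    simp only [List.cons_append, Traces, ih, and_assoc]
    rw [← Function.iterate_add_apply]
    simp [tlen, add_comm]

lemma traces_map_range (f : X → X) (g : ℕ → ℝ → ℕ) (b : ℕ → X × ℕ × ℝ) (z : X) (m : ℕ) :
    tlen ((List.range m).map (fun i => b (i + 1))) = ∑ s ∈ Finset.Ico 1 (m + 1), (b s).2.1 ∧
    ((∀ j, 1 ≤ j → j ≤ m → missCount f (b j).2.1 (b j).1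
        (f^[∑ s ∈ Finset.Ico 1 j, (b s).2.1] z) (b j).2.2 ≤ g (b j).2.1 (b j).2.2) →
      Traces f g z ((List.range m).map (fun i => b (i + 1)))) := by
  induction m with
  | zero => simp [Traces, tlen]
  | succ m ih =>
    rw [List.range_succ, List.map_append, tlen_append, traces_append, ih.1]
    refine ⟨?_, fun h => ⟨ih.2 (fun j h1 h2 => h j h1 (by omega)), ?_⟩⟩
    · rw [Finset.sum_Ico_succ_top (by omega : 1 ≤ m + 1)]
      simp [tlen]
    · simpa [Traces] using h (m + 1) (by omega) le_rfl

lemma coe_restrict_iterate (f : X → X) (A : Set X) (hfA : Set.MapsTo f A A) (n : ℕ) (z : A) :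
    (((Set.MapsTo.restrict f A A hfA)^[n] z : A) : X) = f^[n] (z : X) := by
  induction n generalizing z with
  | zero => rfl
  | succ n ih => rw [Function.iterate_succ_apply, Function.iterate_succ_apply, ih]; rfl

lemma missCount_restrict (f : X → X) (A : Set X) (hfA : Set.MapsTo f A A) (n : ℕ) (x z : A)
    (ε : ℝ) : missCount (Set.MapsTo.restrict f A A hfA) n x z ε = missCount f n (x : X) z ε := by
  unfold missCount
  simp only [Subtype.dist_eq, coe_restrict_iterate]

/-- validity of a list of blocks -/
def Valid (A : Set X) (kg : ℝ → ℕ) (L : List (X × ℕ × ℝ)) : Prop :=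
  ∀ b ∈ L, b.1 ∈ A ∧ 0 < b.2.2 ∧ kg b.2.2 ≤ b.2.1

lemma exists_traces (f : X → X) (A : Set X) (hfA : Set.MapsTo f A A) (a₀ : X) (ha₀ : a₀ ∈ A)
    (g : ℕ → ℝ → ℕ) (kg : ℝ → ℕ)
    (h : AlmostSpecWith (Set.MapsTo.restrict f A A hfA) g kg) (L : List (X × ℕ × ℝ))
    (hL : Valid A kg L) : ∃ z : X, Traces f g z L := by
  rcases Nat.eq_zero_or_pos L.length with h0 | hpos
  · rw [List.length_eq_zero_iff] at h0
    exact ⟨a₀, by simp [h0, Traces]⟩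
  let b : ℕ → X × ℕ × ℝ := fun j => L.getD (j - 1) (a₀, 0, 1)
  have hbm : ∀ j, 1 ≤ j → j ≤ L.length → b j ∈ L := by
    intro j h1 h2
    have : j - 1 < L.length := by omega
    simp only [b, List.getD_eq_getElem _ _ this]
    exact List.getElem_mem _
  have hbA : ∀ j, (b j).1 ∈ A := by
    intro j
    by_cases hj : j - 1 < L.length
    · simp only [b, List.getD_eq_getElem _ _ hj]
      exact (hL _ (List.getElem_mem _)).1
    · simp only [b, List.getD_eq_default _ _ (not_lt.1 hj)]
      exact ha₀
  obtain ⟨z, hz⟩ := h L.length hpos (fun j => (b j).2.2) (fun j => ⟨(b j).1, hbA j⟩)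
    (fun j => (b j).2.1) (fun j h1 h2 => (hL _ (hbm j h1 h2)).2.1)
    (fun j h1 h2 => (hL _ (hbm j h1 h2)).2.2)
  refine ⟨z, ?_⟩
  have hLe : L = (List.range L.length).map (fun i => b (i + 1)) := by
    apply List.ext_getElem
    · simp
    · intro i h1 h2
      simp [b, h1]
  rw [hLe]
  refine (traces_map_range f g b z L.length).2 (fun j h1 h2 => ?_)
  have := (mem_ball_iff _ _ _ _ _ _).1 (hz j h1 h2)
  rw [missCount_restrict, coe_restrict_iterate] at this
  exact this

lemma exists_delta [CompactSpace X] (f : X → X) (hf : Continuous f) (M : ℕ) (ε : ℝ) (hε : 0 < ε) :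
    ∃ δ > 0, ∀ p q : X, dist p q < δ → ∀ j < M, dist (f^[j] p) (f^[j] q) < ε := by
  induction M with
  | zero => exact ⟨1, one_pos, by simp⟩
  | succ M ih =>
    obtain ⟨δ, hδ, h⟩ := ih
    obtain ⟨δ', hδ', h'⟩ := Metric.uniformContinuous_iff.1
      (CompactSpace.uniformContinuous_of_continuous (hf.iterate M)) ε hε
    refine ⟨min δ δ', lt_min hδ hδ', fun p q hpq j hj => ?_⟩
    rcases Nat.lt_succ_iff_lt_or_eq.1 hj with h1 | rfl
    · exact h p q (lt_of_lt_of_le hpq (min_le_left _ _)) j h1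
    · exact h' (lt_of_lt_of_le hpq (min_le_right _ _))

lemma block_list (f : X → X) (A : Set X) (a₀ : X) (ha₀ : a₀ ∈ A)
    (g : ℕ → ℝ → ℕ) (kg : ℝ → ℕ) (ε : ℝ) (hε : 0 < ε) (M : ℕ) (hM : kg ε ≤ M) (hM1 : 1 ≤ M)
    (δ : ℝ) (hδ : ∀ p q : X, dist p q < δ → ∀ j < M, dist (f^[j] p) (f^[j] q) < ε)
    (q : ℕ) (x : X) : ∃ L, Valid A kg L ∧ tlen L = q * M ∧ ∀ z, Traces f g z L →
      missCount f (q * M) x z (2 * ε) ≤ q * g M ε + M * awayCount f A δ (q * M) x := by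
  induction q generalizing x with
  | zero => exact ⟨[], by simp [Valid], by simp [tlen], fun z _ => by simp [missCount]⟩
  | succ q ih =>
    obtain ⟨L, hV, hl, hT⟩ := ih (f^[M] x)
    have key : ∃ a ∈ A, ∀ z, missCount f M a z ε ≤ g M ε →
        missCount f M x z (2 * ε) ≤ g M ε + M * awayCount f A δ M x := by
      by_cases hx : x ∈ thickening δ A
      · obtain ⟨a, ha, hd⟩ := mem_thickening_iff.1 hx
        refine ⟨a, ha, fun z hz => le_trans (le_trans ?_ hz) (Nat.le_add_right _ _)⟩
        unfold missCount
        refine count_le_of_imp M (fun k hk hk1 hk2 => hk1 ?_)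
        have := hδ x a hd k hk
        linarith [dist_triangle (f^[k] x) (f^[k] a) (f^[k] z)]
      · refine ⟨a₀, ha₀, fun z _ => le_trans (missCount_le _ _ _ _ _) ?_⟩
        have := Nat.mul_le_mul_left M (awayCount_pos f A δ M hM1 x hx)
        omega
    obtain ⟨a, ha, hk⟩ := key
    refine ⟨(a, M, ε) :: L, ?_, ?_, ?_⟩
    · intro b hb
      rcases List.mem_cons.1 hb with rfl | hb
      · exact ⟨ha, hε, hM⟩
      · exact hV b hb
    · have : tlen ((a, M, ε) :: L) = M + tlen L := by simp [tlen]
      rw [this, hl]; ring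
    · rintro z ⟨h1, h2⟩
      have e : (q + 1) * M = M + q * M := by ring
      rw [e, missCount_add, awayCount_add]
      have h3 := hk z h1
      have h4 := hT _ h2
      calc _ ≤ _ := add_le_add h3 h4
        _ = _ := by ring

/-- `e` mistakes are enough for segments of length `n` at precision `ε`. -/
def Good (f : X → X) (A : Set X) (g : ℕ → ℝ → ℕ) (kg : ℝ → ℕ) (n : ℕ) (ε : ℝ) (e : ℕ) : Prop :=
  ∀ x : X, ∃ L, Valid A kg L ∧ tlen L = n ∧ ∀ z, Traces f g z L → missCount f n x z ε ≤ e

lemma good_self (f : X → X) (A : Set X) (a₀ : X) (ha₀ : a₀ ∈ A)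
    (g : ℕ → ℝ → ℕ) (kg : ℝ → ℕ) (n : ℕ) (ε : ℝ) (hε : 0 < ε) (hn : kg (ε / 2) ≤ n) :
    Good f A g kg n ε n := fun x =>
  ⟨[(a₀, n, ε / 2)], by simp [Valid, ha₀, hε, hn], by simp [tlen], fun z _ => missCount_le _ _ _ _ _⟩

/-- least number of mistakes -/
noncomputable def G0 (f : X → X) (A : Set X) (g : ℕ → ℝ → ℕ) (kg : ℝ → ℕ) (n : ℕ) (ε : ℝ) : ℕ :=
  sInf {e | Good f A g kg n ε e ∨ e = n}

lemma G0_le (f : X → X) (A : Set X) (g : ℕ → ℝ → ℕ) (kg : ℝ → ℕ) (n : ℕ) (ε : ℝ) :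
    G0 f A g kg n ε ≤ n := Nat.sInf_le (Or.inr rfl)

lemma G0_good (f : X → X) (A : Set X) (a₀ : X) (ha₀ : a₀ ∈ A)
    (g : ℕ → ℝ → ℕ) (kg : ℝ → ℕ) (n : ℕ) (ε : ℝ) (hε : 0 < ε) (hn : kg (ε / 2) ≤ n) :
    Good f A g kg n ε (G0 f A g kg n ε) := by
  have : G0 f A g kg n ε ∈ {e | Good f A g kg n ε e ∨ e = n} := Nat.sInf_mem ⟨n, Or.inr rfl⟩
  rcases this with h | h
  · exact h
  · rw [h]; exact good_self f A a₀ ha₀ g kg n ε hε hn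

lemma G0_small [CompactSpace X] [MeasurableSpace X] [BorelSpace X]
    (f : X → X) (hf : Continuous f) (A : Set X)
    (hA : IsClosed A) (hmc : measureCenter f ⊆ A) (a₀ : X) (ha₀ : a₀ ∈ A)
    (g : ℕ → ℝ → ℕ) (kg : ℝ → ℕ) (ε : ℝ) (hε : 0 < ε)
    (hg : Tendsto (fun n : ℕ => (g n (ε / 2) : ℝ) / n) atTop (nhds 0)) (τ : ℝ) (hτ : 0 < τ) :
    ∃ N : ℕ, ∀ n, N ≤ n → (G0 f A g kg n ε : ℝ) ≤ τ * n := by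
  obtain ⟨M, hM1, hM2, hM3⟩ := ((hg.eventually (gt_mem_nhds (by positivity : 0 < τ / 3))).and
    ((eventually_ge_atTop 1).and (eventually_ge_atTop (kg (ε / 2))))).exists
  have hMpos : (0 : ℝ) < M := by exact_mod_cast hM2
  obtain ⟨δ, hδ, hδ'⟩ := exists_delta f hf M (ε / 2) (by positivity)
  obtain ⟨N, hN⟩ := awayCount_small f hf A hA hmc δ hδ (τ / (3 * M)) (by positivity)
  obtain ⟨N', hN'⟩ := exists_nat_gt (6 * M / τ)
  refine ⟨max (max N N') M, fun n hn => ?_⟩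
  simp only [max_le_iff] at hn
  obtain ⟨⟨hn1, hn2⟩, hn3⟩ := hn
  -- decomposition `n = (M + r) + q * M`
  obtain ⟨q, r, hr, hqr⟩ : ∃ q r, r < M ∧ n = (M + r) + q * M := by
    refine ⟨(n - M) / M, (n - M) % M, Nat.mod_lt _ hM2, ?_⟩
    have := Nat.mod_add_div' (n - M) M
    omega
  let K : ℕ := 2 * M + q * g M (ε / 2) + M * ⌊τ / (3 * M) * n⌋₊
  have hgood : Good f A g kg n ε K := by
    intro x
    obtain ⟨L, hV, hl, hT⟩ := block_list f A a₀ ha₀ g kg (ε / 2) (by positivity) M hM3 hM2 δ hδ' q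
      (f^[M + r] x)
    refine ⟨(a₀, M + r, ε / 2) :: L, ?_, ?_, ?_⟩
    · intro b hb
      rcases List.mem_cons.1 hb with rfl | hb
      · exact ⟨ha₀, by positivity, by change kg (ε / 2) ≤ M + r; omega⟩
      · exact hV b hb
    · have : tlen ((a₀, M + r, ε / 2) :: L) = M + r + tlen L := by simp [tlen]
      rw [this, hl, hqr]
    · rintro z ⟨-, h2⟩
      have h3 := hT _ h2
      rw [mul_div_cancel₀ ε (two_ne_zero)] at h3
      have h4 : awayCount f A δ (q * M) (f^[M + r] x) ≤ ⌊τ / (3 * M) * n⌋₊ := by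
        have : awayCount f A δ (q * M) (f^[M + r] x) ≤ awayCount f A δ n x := by
          rw [hqr, awayCount_add f A δ (M + r)]; omega
        exact this.trans (Nat.le_floor (hN n hn1 x))
      have h5 := Nat.mul_le_mul_left M h4
      have h6 := missCount_le f (M + r) x z ε
      rw [hqr, missCount_add]
      simp only [K]
      change missCount f (q * M) (f^[M + r] x) (f^[M + r] z) ε ≤ _ at h3
      omega
  have h1 : (G0 f A g kg n ε : ℝ) ≤ K := by
    exact_mod_cast Nat.sInf_le (Or.inl hgood)
  refine h1.trans ?_
  have e1 : (2 * M : ℝ) ≤ τ / 3 * n := by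
    have : 6 * M / τ ≤ n := hN'.le.trans (by exact_mod_cast hn2)
    rw [div_le_iff₀ hτ] at this
    linarith
  have e2 : (q * g M (ε / 2) : ℝ) ≤ τ / 3 * n := by
    have a1 : (g M (ε / 2) : ℝ) ≤ τ / 3 * M := by
      rw [div_lt_iff₀ hMpos] at hM1; exact hM1.le
    have a2 : (q * M : ℝ) ≤ n := by
      have : q * M ≤ n := by omega
      exact_mod_cast this
    calc (q * g M (ε / 2) : ℝ) ≤ q * (τ / 3 * M) := by gcongr
      _ = τ / 3 * (q * M) := by ring
      _ ≤ _ := by gcongr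
  have e3 : (M * ⌊τ / (3 * M) * n⌋₊ : ℝ) ≤ τ / 3 * n := by
    have := Nat.floor_le (by positivity : (0 : ℝ) ≤ τ / (3 * M) * n)
    calc (M * ⌊τ / (3 * M) * n⌋₊ : ℝ) ≤ M * (τ / (3 * M) * n) := by gcongr
      _ = _ := by field_simp
  simp only [K]
  push_cast
  linarith

end Comb

/-- If a closed invariant set `A` contains the measure center and
`f|_A` has the almost specification property, then so does `f`. -/
theorem almostSpec_of_restriction_to_measureCenter
    {X : Type*} [MetricSpace X] [CompactSpace X] [MeasurableSpace X] [BorelSpace X]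
    (f : X → X) (hf : Continuous f)
    (A : Set X) (hA : IsClosed A) (hfA : Set.MapsTo f A A)
    (hmc : measureCenter f ⊆ A)
    (h : AlmostSpec (Set.MapsTo.restrict f A A hfA)) : AlmostSpec f := by
  classical
  rcases isEmpty_or_nonempty X with hX | ⟨⟨x₀⟩⟩
  · refine ⟨fun _ _ => 0, 1, fun _ => 0, ⟨one_pos, fun _ _ _ _ => le_rfl, fun _ _ _ => by simp,
      fun _ _ _ => rfl⟩, fun m _ ε x => (hX.false (x 0)).elim⟩
  obtain ⟨a₀, ha₀⟩ : A.Nonempty := by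
    by_contra hne
    rw [Set.not_nonempty_iff_eq_empty] at hne
    obtain ⟨N, hN⟩ := awayCount_small f hf A hA hmc 1 one_pos (1 / 2) (by norm_num)
    have h1 := hN (N + 1) (by omega) x₀
    have h2 : awayCount f A 1 (N + 1) x₀ = N + 1 := by
      unfold awayCount
      rw [Nat.count_iff_forall]
      simp [hne]
    rw [h2] at h1
    have : (0 : ℝ) < (N + 1 : ℕ) := by positivity
    linarith
  obtain ⟨g, ε₀, kg, hg, hspec⟩ := h
  have hε₀ := hg.pos
  let G : ℕ → ℝ → ℕ := fun n ε => (Finset.range (n + 1)).sup (fun k => G0 f A g kg k (min ε ε₀))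
  refine ⟨G, ε₀, fun ε => kg (min ε ε₀ / 2), ⟨hε₀, ?_, ?_, ?_⟩, ?_⟩
  · intro n ε _ _
    exact Finset.sup_mono (Finset.range_mono (by omega))
  · intro ε hε hε'
    have hg2 := hg.small (ε / 2) (by positivity) (by linarith)
    rw [Metric.tendsto_atTop]
    intro τ hτ
    obtain ⟨N, hN⟩ := G0_small f hf A hA hmc a₀ ha₀ g kg ε hε hg2 (τ / 2) (by positivity)
    obtain ⟨N', hN'⟩ := exists_nat_gt (N / (τ / 2))
    refine ⟨max N' 1, fun n hn => ?_⟩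
    replace hn := max_le_iff.1 hn
    have hnpos : (0 : ℝ) < n := by exact_mod_cast hn.2
    have hb : (N : ℝ) ≤ τ / 2 * n := by
      have : (N : ℝ) / (τ / 2) ≤ n := hN'.le.trans (by exact_mod_cast hn.1)
      rw [div_le_iff₀ (by positivity)] at this
      linarith
    have hG : (G n ε : ℝ) ≤ τ / 2 * n := by
      obtain ⟨k, hk, hk'⟩ := Finset.exists_mem_eq_sup (Finset.range (n + 1)) (by simp)
        (fun k => G0 f A g kg k (min ε ε₀))
      have e : G n ε = G0 f A g kg k ε := by
        simp only [G, hk', min_eq_left hε']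
      rw [e]
      have hkn : (k : ℝ) ≤ n := by
        have := Finset.mem_range.1 hk
        exact_mod_cast Nat.lt_succ_iff.1 this
      rcases le_total N k with h1 | h1
      · exact (hN k h1).trans (by gcongr)
      · have h2 : (G0 f A g kg k ε : ℝ) ≤ N := by exact_mod_cast (G0_le f A g kg k ε).trans h1
        exact h2.trans hb
    rw [Real.dist_eq, sub_zero, abs_of_nonneg (by positivity), div_lt_iff₀ hnpos]
    nlinarith
  · intro n ε hε
    simp only [G, min_eq_right hε.le, min_self]
  · intro m _ ε x nseq hε hn
    have hl : ∀ k, k ≤ m → ∃ L, Valid A kg L ∧ tlen L = ∑ s ∈ Finset.Ico 1 (k + 1), nseq s ∧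
        ∀ z, Traces f g z L → ∀ j, 1 ≤ j → j ≤ k →
          f^[∑ s ∈ Finset.Ico 1 j, nseq s] z ∈ mistakeBowenBall f G (nseq j) (x j) (ε j) := by
      intro k
      induction k with
      | zero => exact fun _ => ⟨[], by simp [Valid], by simp [tlen], fun z _ j h1 h2 => by omega⟩
      | succ k ih =>
        intro hk
        obtain ⟨L, hV, hL, hT⟩ := ih (by omega)
        have hεk : 0 < min (ε (k + 1)) ε₀ := lt_min (hε (k + 1) (by omega) hk) hε₀
        obtain ⟨L', hV', hL', hT'⟩ := G0_good f A a₀ ha₀ g kg (nseq (k + 1)) (min (ε (k + 1)) ε₀)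
          hεk (hn (k + 1) (by omega) hk) (x (k + 1))
        refine ⟨L ++ L', ?_, ?_, ?_⟩
        · intro b hb
          rcases List.mem_append.1 hb with hb | hb
          · exact hV b hb
          · exact hV' b hb
        · rw [tlen_append, hL, hL', Finset.sum_Ico_succ_top (by omega : 1 ≤ k + 1)]
        · intro z hz j h1 h2
          rw [traces_append] at hz
          rcases Nat.le_succ_iff.1 h2 with h3 | rfl
          · exact hT z hz.1 j h1 h3
          · rw [mem_ball_iff]
            have h4 := hT' _ hz.2
            rw [hL] at h4
            refine (missCount_anti f _ _ _ (min_le_left _ ε₀)).trans (h4.trans ?_)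
            exact Finset.le_sup (f := fun i => G0 f A g kg i (min (ε (k + 1)) ε₀))
              (Finset.self_mem_range_succ (nseq (k + 1)))
    obtain ⟨L, hV, -, hT⟩ := hl m le_rfl
    obtain ⟨z, hz⟩ := exists_traces f A hfA a₀ ha₀ g kg hspec L hV
    exact ⟨z, hT z hz⟩
end
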